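/- (Lemma 4.4, 1D case.) Define the linear functional Y^{n,ℓ}(v) = τ^{−1} ∫_Ω (u_σ^{n,ℓ+1} − u_h^{n,ℓ+1}) v dx on V^k. Assume the partition is quasi-uniform, τ ≤ C_CFL h^κ with κ ≥ 1, ‖u_h^{n,m} − avg(u_h^{n,m})‖_{L∞(Ω)} ≥ c₀ > 0 for all relevant stages, and ‖ξ^{n,m}‖_{L∞(Ω)} ≤ h for all 1 ≤ m ≤ ℓ+1. Then there is a constant C, independent of h, τ, and n (depending on k, s, r, the Runge–Kutta coefficients, β, γ, c₀, and Sobolev norms of u), such that ‖Y^{n,ℓ}‖ ≤ C (‖ξ_σ^n‖_{L²(Ω)} + h^{k+1} + τ^r). -/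

import Mathlib

open Polynomial Finset MeasureTheory

namespace OEDG

variable {N : ℕ}

/-- `pt` lists the nodes `x_{1/2} < x_{3/2} < … < x_{N+1/2}` of a partition of `Ω = [0,1]`. -/
def IsMesh (pt : Fin (N+1) → ℝ) : Prop :=
  pt 0 = 0 ∧ pt (Fin.last N) = 1 ∧ StrictMono pt

/-- Left endpoint of cell `j`. -/
def ptL (pt : Fin (N+1) → ℝ) (j : Fin N) : ℝ := pt j.castSucc

/-- Right endpoint of cell `j`. -/
def ptR (pt : Fin (N+1) → ℝ) (j : Fin N) : ℝ := pt j.succ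

/-- Length `h_j` of cell `j`. -/
def cellh (pt : Fin (N+1) → ℝ) (j : Fin N) : ℝ := ptR pt j - ptL pt j

/-- Maximal mesh size `h`. -/
noncomputable def meshSize (pt : Fin (N+1) → ℝ) : ℝ := ⨆ j : Fin N, cellh pt j

/-- Quasi-uniformity of the partition: `h ≤ γ h_j` for all `j`. -/
def QuasiUniform (pt : Fin (N+1) → ℝ) (γ : ℝ) : Prop :=
  ∀ j : Fin N, meshSize pt ≤ γ * cellh pt j

/-- Membership in `V^k`: every cell polynomial has degree at most `k`. -/
def MemVk (k : ℕ) (u : Fin N → Polynomial ℝ) : Prop :=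
  ∀ j, (u j).natDegree ≤ k

/-- Cellwise `L²` inner product. -/
noncomputable def cip (pt : Fin (N+1) → ℝ) (j : Fin N) (p q : Polynomial ℝ) : ℝ :=
  ∫ x in (ptL pt j)..(ptR pt j), p.eval x * q.eval x

/-- Global `L²(Ω)` inner product of piecewise polynomials. -/
noncomputable def ip (pt : Fin (N+1) → ℝ) (u v : Fin N → Polynomial ℝ) : ℝ :=
  ∑ j : Fin N, cip pt j (u j) (v j)

/-- Cellwise `L²` norm. -/
noncomputable def cl2 (pt : Fin (N+1) → ℝ) (j : Fin N) (p : Polynomial ℝ) : ℝ :=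
  Real.sqrt (cip pt j p p)

/-- Global `L²(Ω)` norm of a piecewise polynomial. -/
noncomputable def l2 (pt : Fin (N+1) → ℝ) (u : Fin N → Polynomial ℝ) : ℝ :=
  Real.sqrt (ip pt u u)

/-- Average `avg(u) = (1/|Ω|) ∫_Ω u dx` (here `|Ω| = 1`). -/
noncomputable def avg (pt : Fin (N+1) → ℝ) (u : Fin N → Polynomial ℝ) : ℝ :=
  ∑ j : Fin N, ∫ x in (ptL pt j)..(ptR pt j), (u j).eval x

/-- `‖u - c‖_{L∞(Ω)}` for a piecewise polynomial `u` and a constant `c`. -/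
noncomputable def linfSub (pt : Fin (N+1) → ℝ) (u : Fin N → Polynomial ℝ) (c : ℝ) : ℝ :=
  ⨆ j : Fin N, sSup ((fun x => |(u j).eval x - c|) '' Set.Icc (ptL pt j) (ptR pt j))

/-- `m`-th derivative of a polynomial. -/
noncomputable def pderiv (m : ℕ) (p : Polynomial ℝ) : Polynomial ℝ :=
  (fun q : Polynomial ℝ => Polynomial.derivative q)^[m] p

/-- Jump `[∂_x^m u]_{j+1/2}` of the `m`-th derivative at the interface to the right of
cell `j`, with periodic identification of `x_{N+1/2}` with `x_{1/2}`. -/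
noncomputable def jumpD [NeZero N] (pt : Fin (N+1) → ℝ) (u : Fin N → Polynomial ℝ)
    (m : ℕ) (j : Fin N) : ℝ :=
  (pderiv m (u (j+1))).eval (pt (Fin.castSucc (j+1))) - (pderiv m (u j)).eval (pt j.succ)

/-- The scale-invariant damping coefficient `σ_j^m(u)` of the OEDG method. -/
noncomputable def sigma [NeZero N] (k : ℕ) (pt : Fin (N+1) → ℝ)
    (u : Fin N → Polynomial ℝ) (m : ℕ) (j : Fin N) : ℝ :=
  if ∀ i, u i = Polynomial.C (avg pt u) then 0
  else (2*(m:ℝ)+1) * (cellh pt j)^m / ((2*(k:ℝ)-1) * (Nat.factorial m)) *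
    ((|jumpD pt u m (j-1)| + |jumpD pt u m j|) / (2 * linfSub pt u (avg pt u)))

/-- Damping rate `δ_j^m = β_j σ_j^m(u) / h_j`. -/
noncomputable def dampRate [NeZero N] (k : ℕ) (pt : Fin (N+1) → ℝ) (β : Fin N → ℝ)
    (u : Fin N → Polynomial ℝ) (m : ℕ) (j : Fin N) : ℝ :=
  β j * sigma k pt u m j / cellh pt j

/-- `Pc j d` is the cellwise `L²(I_j)`-orthogonal projection onto `ℙ^d(I_j)`.
(The family `Pc` realizes the global projections `P^d` onto `V^d`.) -/
def IsCellProj (pt : Fin (N+1) → ℝ)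
    (Pc : Fin N → ℕ → Polynomial ℝ → Polynomial ℝ) : Prop :=
  ∀ (j : Fin N) (dd : ℕ) (p : Polynomial ℝ), (Pc j dd p).natDegree ≤ dd ∧
    ∀ q : Polynomial ℝ, q.natDegree ≤ dd → cip pt j (p - Pc j dd p) q = 0

/-- `w` solves the damping initial value problem with initial data `u`:
`d/dt̂ ∫_{I_j} u_σ v dx + ∑_{m=0}^k (β_j σ_j^m(u)/h_j) ∫_{I_j} (u_σ - P^{m-1} u_σ) v dx = 0`
for every `v ∈ ℙ^k(I_j)` and every `j`, with `u_σ(·,0) = u`.  (Note `m - 1` is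
truncated ℕ-subtraction, which realizes the convention `P^{-1} = P^0`.) -/
def IsDampingSol [NeZero N] (k : ℕ) (pt : Fin (N+1) → ℝ) (β : Fin N → ℝ)
    (Pc : Fin N → ℕ → Polynomial ℝ → Polynomial ℝ)
    (u : Fin N → Polynomial ℝ) (w : ℝ → Fin N → Polynomial ℝ) : Prop :=
  w 0 = u ∧ (∀ t j, (w t j).natDegree ≤ k) ∧
  ∀ (t : ℝ) (j : Fin N) (v : Polynomial ℝ), v.natDegree ≤ k →
    HasDerivAt (fun s => cip pt j (w s j) v)
      (-(∑ m ∈ Finset.range (k+1),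
        dampRate k pt β u m j * cip pt j (w t j - Pc j (m-1) (w t j)) v)) t

/-- `Fτ` is the OE (oscillation-eliminating) operator: for every `u ∈ V^k` the damping
initial value problem has a solution `w` and `Fτ u = w τ`. -/
def IsOEOp [NeZero N] (k : ℕ) (pt : Fin (N+1) → ℝ) (β : Fin N → ℝ)
    (Pc : Fin N → ℕ → Polynomial ℝ → Polynomial ℝ) (τ : ℝ)
    (Fτ : (Fin N → Polynomial ℝ) → (Fin N → Polynomial ℝ)) : Prop :=
  ∀ u, MemVk k u → ∃ w, IsDampingSol k pt β Pc u w ∧ Fτ u = w τ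

/-- Right-hand side of the weak form of the upwind DG operator for `u_t + β u_x = 0`:
`β ∫_{I_j} w v_x dx - β w(x_{j+1/2}^-) v(x_{j+1/2}^-) + β w(x_{j-1/2}^-) v(x_{j-1/2}^+)`. -/
noncomputable def dgRHS [NeZero N] (pt : Fin (N+1) → ℝ) (β : ℝ)
    (w : Fin N → Polynomial ℝ) (j : Fin N) (v : Polynomial ℝ) : ℝ :=
  β * (∫ x in (ptL pt j)..(ptR pt j), (w j).eval x * (Polynomial.derivative v).eval x)
  - β * (w j).eval (ptR pt j) * v.eval (ptR pt j)
  + β * (w (j-1)).eval (pt (j-1).succ) * v.eval (ptL pt j)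

/-- `L` is the upwind DG spatial operator on `V^k`. -/
def IsDGOp [NeZero N] (k : ℕ) (pt : Fin (N+1) → ℝ) (β : ℝ)
    (L : (Fin N → Polynomial ℝ) → (Fin N → Polynomial ℝ)) : Prop :=
  ∀ w, MemVk k w → MemVk k (L w) ∧
    ∀ (j : Fin N) (v : Polynomial ℝ), v.natDegree ≤ k →
      cip pt j (L w j) v = dgRHS pt β w j v

/-- The upwind DG bilinear form
`H(w,v) = β ∑_j ∫_{I_j} w v_x dx + β ∑_j w(x_{j+1/2}^-) [v]_{j+1/2}`. -/
noncomputable def Hform [NeZero N] (pt : Fin (N+1) → ℝ) (β : ℝ)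
    (w v : Fin N → Polynomial ℝ) : ℝ :=
  β * ∑ j : Fin N, (∫ x in (ptL pt j)..(ptR pt j),
      (w j).eval x * (Polynomial.derivative (v j)).eval x)
  + β * ∑ j : Fin N, (w j).eval (ptR pt j) * jumpD pt v 0 j

/-- The upwind DG bilinear form with piecewise-smooth first argument. -/
noncomputable def HformF [NeZero N] (pt : Fin (N+1) → ℝ) (β : ℝ)
    (w : Fin N → ℝ → ℝ) (v : Fin N → Polynomial ℝ) : ℝ :=
  β * ∑ j : Fin N, (∫ x in (ptL pt j)..(ptR pt j),
      w j x * (Polynomial.derivative (v j)).eval x)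
  + β * ∑ j : Fin N, w j (ptR pt j) * jumpD pt v 0 j

/-- `L²(Ω)` pairing of a piecewise-smooth function with a piecewise polynomial. -/
noncomputable def ipF (pt : Fin (N+1) → ℝ) (w : Fin N → ℝ → ℝ)
    (v : Fin N → Polynomial ℝ) : ℝ :=
  ∑ j : Fin N, ∫ x in (ptL pt j)..(ptR pt j), w j x * (v j).eval x

/-- One Runge–Kutta stage: `∑_{0≤m≤ℓ} (c_{ℓm} u_σ^{n,m} + τ d_{ℓm} L(u_σ^{n,m}))`. -/
noncomputable def rkStage [NeZero N] (c d : ℕ → ℕ → ℝ) (τ : ℝ)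
    (L : (Fin N → Polynomial ℝ) → (Fin N → Polynomial ℝ))
    (uσ : ℕ → Fin N → Polynomial ℝ) (ℓ : ℕ) : Fin N → Polynomial ℝ :=
  fun j => ∑ m ∈ Finset.range (ℓ+1),
    (Polynomial.C (c ℓ m) * uσ m j + Polynomial.C (τ * d ℓ m) * L (uσ m) j)

/-- One full OEDG time step from `u_σ^n = un`: the stages `u_h^{n,ℓ+1}` and
`u_σ^{n,ℓ+1} = F_τ u_h^{n,ℓ+1}`, `0 ≤ ℓ ≤ s-1`. -/
def IsOEDGStep [NeZero N] (s : ℕ) (c d : ℕ → ℕ → ℝ) (τ : ℝ)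
    (L Fτ : (Fin N → Polynomial ℝ) → (Fin N → Polynomial ℝ))
    (un : Fin N → Polynomial ℝ) (uh uσ : ℕ → Fin N → Polynomial ℝ) : Prop :=
  uσ 0 = un ∧ ∀ ℓ < s, uh (ℓ+1) = rkStage c d τ L uσ ℓ ∧ uσ (ℓ+1) = Fτ (uh (ℓ+1))

/-- The full OEDG evolution: `uσ n ℓ = u_σ^{n,ℓ}` and `uh n ℓ = u_h^{n,ℓ}`, starting from
`u_σ^0 = u0`, with `u_σ^{n+1} = u_σ^{n,s}`. -/
def IsOEDGEvol [NeZero N] (s : ℕ) (c d : ℕ → ℕ → ℝ) (τ : ℝ)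
    (L Fτ : (Fin N → Polynomial ℝ) → (Fin N → Polynomial ℝ))
    (u0 : Fin N → Polynomial ℝ) (uh uσ : ℕ → ℕ → Fin N → Polynomial ℝ) : Prop :=
  uσ 0 0 = u0 ∧ ∀ n, uσ (n+1) 0 = uσ n s ∧
    ∀ ℓ < s, uh n (ℓ+1) = rkStage c d τ L (uσ n) ℓ ∧ uσ n (ℓ+1) = Fτ (uh n (ℓ+1))

/-- `p` is the Gauss–Radau projection of `w` on `[a,b]` into `ℙ^k`:
`∫_a^b (w - p) q dx = 0` for all `q ∈ ℙ^{k-1}` and `p(b) = w(b)`. -/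
def IsGRProj (k : ℕ) (a b : ℝ) (w : ℝ → ℝ) (p : Polynomial ℝ) : Prop :=
  p.natDegree ≤ k ∧
  (∀ q : Polynomial ℝ, q.natDegree < k →
    (∫ x in a..b, (w x - p.eval x) * q.eval x) = 0) ∧
  p.eval b = w b

/-- `u = u(x,t)` is a smooth `1`-periodic exact solution of `u_t + β u_x = 0`. -/
def IsSmoothSolution (β : ℝ) (u : ℝ → ℝ → ℝ) : Prop :=
  ContDiff ℝ (⊤ : ℕ∞) (fun p : ℝ × ℝ => u p.1 p.2) ∧
  (∀ x t, u (x+1) t = u x t) ∧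
  (∀ x t, deriv (fun s => u x s) t + β * deriv (fun y => u y t) x = 0)

/-- Auxiliary table for the reference functions `U^{n,ℓ}`. -/
noncomputable def UrefUpTo (u : ℝ → ℝ → ℝ) (c d : ℕ → ℕ → ℝ) (β τ : ℝ) (n : ℕ) :
    ℕ → ℕ → ℝ → ℝ
  | 0 => fun _ => fun x => u x ((n:ℝ) * τ)
  | (ℓ+1) => fun i =>
      if i ≤ ℓ then UrefUpTo u c d β τ n ℓ i
      else fun x => ∑ m ∈ Finset.range (ℓ+1),
        (c ℓ m * UrefUpTo u c d β τ n ℓ m x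
          - τ * d ℓ m * β * deriv (UrefUpTo u c d β τ n ℓ m) x)

/-- Reference function `U^{n,ℓ}` (for `0 ≤ ℓ ≤ s-1`): `U^{n,0} = u(·, t^n)` and
`U^{n,ℓ+1} = ∑_{0≤m≤ℓ} (c_{ℓm} U^{n,m} - τ d_{ℓm} β ∂_x U^{n,m})`. -/
noncomputable def Uref (u : ℝ → ℝ → ℝ) (c d : ℕ → ℕ → ℝ) (β τ : ℝ) (n ℓ : ℕ) : ℝ → ℝ :=
  UrefUpTo u c d β τ n ℓ ℓ

/-- Reference function `U^{n,ℓ}` including the final stage `U^{n,s} := u(·, t^{n+1})`. -/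
noncomputable def UrefS (u : ℝ → ℝ → ℝ) (c d : ℕ → ℕ → ℝ) (β τ : ℝ) (s n ℓ : ℕ) : ℝ → ℝ :=
  if ℓ = s then fun x => u x (((n:ℝ)+1) * τ) else Uref u c d β τ n ℓ

/-- The Runge–Kutta residual `ρ^{n,s-1}`, defined so that
`U^{n,s} = ∑_{0≤m≤s-1} (c_{s-1,m} U^{n,m} - τ d_{s-1,m} β ∂_x U^{n,m}) + τ ρ^{n,s-1}`. -/
noncomputable def rkRes (u : ℝ → ℝ → ℝ) (c d : ℕ → ℕ → ℝ) (β τ : ℝ) (s n : ℕ) : ℝ → ℝ :=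
  fun x => (u x (((n:ℝ)+1) * τ) - ∑ m ∈ Finset.range s,
    (c (s-1) m * Uref u c d β τ n m x
      - τ * d (s-1) m * β * deriv (Uref u c d β τ n m) x)) / τ

/-- `L²(0,1)` norm of a function. -/
noncomputable def fl2 (f : ℝ → ℝ) : ℝ := Real.sqrt (∫ x in (0:ℝ)..1, (f x)^2)

/-- `L²(Ω)` distance between a piecewise polynomial and a function. -/
noncomputable def errL2 (pt : Fin (N+1) → ℝ) (w : Fin N → Polynomial ℝ) (f : ℝ → ℝ) : ℝ :=
  Real.sqrt (∑ j : Fin N, ∫ x in (ptL pt j)..(ptR pt j), ((w j).eval x - f x)^2)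

/-! ### Polynomial estimates on one interval -/

/-- Cauchy–Schwarz inequality for continuous functions on an interval. -/
theorem abs_integral_mul_le {a b : ℝ} (hab : a ≤ b) {f g : ℝ → ℝ}
    (hf : Continuous f) (hg : Continuous g) :
    |∫ x in a..b, f x * g x| ≤
      Real.sqrt (∫ x in a..b, f x ^ 2) * Real.sqrt (∫ x in a..b, g x ^ 2) := by
  have hff : 0 ≤ ∫ x in a..b, f x ^ 2 :=
    intervalIntegral.integral_nonneg hab fun x _ => sq_nonneg _
  have key : ∀ t : ℝ, 0 ≤ (∫ x in a..b, g x ^ 2) * (t * t)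
      + (2 * ∫ x in a..b, f x * g x) * t + ∫ x in a..b, f x ^ 2 := by
    intro t
    have h0 : 0 ≤ ∫ x in a..b, (f x + t * g x) ^ 2 :=
      intervalIntegral.integral_nonneg hab fun x _ => sq_nonneg _
    have h1 : ∫ x in a..b, (f x + t * g x) ^ 2
        = (∫ x in a..b, f x ^ 2) + ((2 * t) * ∫ x in a..b, f x * g x)
          + t ^ 2 * ∫ x in a..b, g x ^ 2 := by
      rw [← intervalIntegral.integral_const_mul, ← intervalIntegral.integral_const_mul,
        ← intervalIntegral.integral_add, ← intervalIntegral.integral_add]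
      · exact intervalIntegral.integral_congr fun x _ => by ring
      all_goals exact Continuous.intervalIntegrable (by fun_prop) _ _
    rw [h1] at h0
    linarith
  have h2 := discrim_le_zero key
  rw [discrim] at h2
  rw [← Real.sqrt_mul hff]
  apply Real.abs_le_sqrt
  linarith

/-- Weighted norm equivalence on polynomials of bounded degree. -/
theorem exists_coeff_sq_le (k : ℕ) : ∃ K : ℝ, 0 < K ∧ ∀ p : ℝ[X], p.natDegree ≤ k →
    ∀ i, p.coeff i ^ 2 ≤ K * ∫ x in (0:ℝ)..1, (1 - x) * p.eval x ^ 2 := by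
  set F : (Fin (k+1) → ℝ) → ℝ :=
    fun a => ∫ x in (0:ℝ)..1, (1 - x) * (∑ i, a i * x ^ (i:ℕ)) ^ 2 with hF
  have hFc : Continuous F := by
    apply intervalIntegral.continuous_parametric_intervalIntegral_of_continuous'
    unfold Function.uncurry
    fun_prop
  have hpos : ∀ a : Fin (k+1) → ℝ, a ≠ 0 → 0 < F a := by
    intro a ha
    set p : ℝ[X] := ∑ i : Fin (k+1), C (a i) * X ^ (i:ℕ) with hp
    have hcoeff : ∀ i : Fin (k+1), p.coeff i = a i := by
      intro i
      simp only [hp, finsetSum_coeff, coeff_C_mul, coeff_X_pow]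
      rw [Finset.sum_eq_single i]
      · simp
      · intro j _ hj
        rw [if_neg (fun h => hj (Fin.ext h.symm)), mul_zero]
      · simp
    have hp0 : p ≠ 0 := by
      rintro h0
      apply ha
      funext i
      rw [← hcoeff i, h0]
      simp
    have hev : ∀ x, ∑ i, a i * x ^ (i:ℕ) = p.eval x := by
      intro x
      simp [hp, eval_finsetSum]
    obtain ⟨x, hx, hxr⟩ : ∃ x ∈ Set.Ioo (0:ℝ) 1, p.eval x ≠ 0 := by
      by_contra! hcon
      exact hp0 (Polynomial.eq_zero_of_infinite_isRoot p
        ((Set.Ioo_infinite zero_lt_one).mono fun x hx => hcon x hx))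
    apply intervalIntegral.integral_pos zero_lt_one
    · exact Continuous.continuousOn (by fun_prop)
    · intro y hy
      exact mul_nonneg (by linarith [hy.2]) (sq_nonneg _)
    · refine ⟨x, ⟨hx.1.le, hx.2.le⟩, ?_⟩
      rw [hev]
      exact mul_pos (by linarith [hx.2]) (by positivity)
  obtain ⟨a₀, ha₀, hmin⟩ := (isCompact_sphere (0 : Fin (k+1) → ℝ) 1).exists_isMinOn
    (NormedSpace.sphere_nonempty.mpr zero_le_one) hFc.continuousOn
  have ha₀' : a₀ ≠ 0 := by
    rintro rfl
    simp at ha₀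
  have hm := hpos a₀ ha₀'
  refine ⟨(F a₀)⁻¹, inv_pos.mpr hm, ?_⟩
  intro p hp i
  set a : Fin (k+1) → ℝ := fun i => p.coeff i with ha
  have hFa : F a = ∫ x in (0:ℝ)..1, (1 - x) * p.eval x ^ 2 := by
    apply intervalIntegral.integral_congr
    intro x _
    simp only [ha]
    rw [Fin.sum_univ_eq_sum_range (fun i => p.coeff i * x ^ i) (k+1),
      ← Polynomial.eval_eq_sum_range' (Nat.lt_succ_of_le hp)]
  have hint : 0 ≤ F a := by
    rw [hFa]
    exact intervalIntegral.integral_nonneg zero_le_one fun x hx =>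
      mul_nonneg (by linarith [hx.2]) (sq_nonneg _)
  rw [← hFa]
  by_cases hi : i ≤ k
  · by_cases hz : a = 0
    · have : p.coeff i = 0 := congrFun hz ⟨i, Nat.lt_succ_of_le hi⟩
      rw [this, zero_pow two_ne_zero]
      have := inv_pos.mpr hm
      positivity
    · have hn : 0 < ‖a‖ := norm_pos_iff.mpr hz
      have hmem : (‖a‖⁻¹ • a) ∈ Metric.sphere (0 : Fin (k+1) → ℝ) 1 := by
        simp [norm_smul, hn.ne']
      have h1 : F a₀ ≤ F (‖a‖⁻¹ • a) := hmin hmem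
      have h2 : F (‖a‖⁻¹ • a) = (‖a‖⁻¹) ^ 2 * F a := by
        simp only [hF, Pi.smul_apply, smul_eq_mul]
        rw [← intervalIntegral.integral_const_mul]
        apply intervalIntegral.integral_congr
        intro x _
        simp only [mul_assoc, ← Finset.mul_sum]
        ring
      have h3 : ‖a‖ ^ 2 * F a₀ ≤ F a := by
        rw [h2] at h1
        calc ‖a‖ ^ 2 * F a₀ ≤ ‖a‖ ^ 2 * ((‖a‖⁻¹) ^ 2 * F a) := by gcongr
          _ = F a := by field_simp
      have h4 : p.coeff i ^ 2 ≤ ‖a‖ ^ 2 := by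
        have := norm_le_pi_norm a ⟨i, Nat.lt_succ_of_le hi⟩
        rw [← sq_abs]
        exact pow_le_pow_left₀ (abs_nonneg _) this 2
      rw [inv_mul_eq_div, le_div_iff₀ hm]
      exact (mul_le_mul_of_nonneg_right h4 hm.le).trans h3
  · rw [Polynomial.coeff_eq_zero_of_natDegree_lt (by omega), zero_pow two_ne_zero]
    have := inv_pos.mpr hm
    positivity

theorem descFactorial_le_factorial_of_le {i k m : ℕ} (hi : i ≤ k) :
    i.descFactorial m ≤ k.factorial := by
  refine le_trans ?_ (Nat.factorial_le hi)
  by_cases hm : m ≤ i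
  · rw [← Nat.factorial_mul_descFactorial hm]
    exact Nat.le_mul_of_pos_left _ (Nat.factorial_pos _)
  · rw [Nat.descFactorial_of_lt (by omega)]
    exact Nat.zero_le _

theorem abs_eval_iterate_derivative_le {k : ℕ} {p : ℝ[X]} (hp : p.natDegree ≤ k) (m : ℕ)
    {x : ℝ} (hx : x ∈ Set.Icc (0:ℝ) 1) {B : ℝ} (hB : ∀ i, |p.coeff i| ≤ B) :
    |(derivative^[m] p).eval x| ≤ (k + 1) * (k.factorial * B) := by
  have hB0 : 0 ≤ B := (abs_nonneg _).trans (hB 0)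
  have hsum : (derivative^[m] p).eval x
      = ∑ i ∈ Finset.range (k+1), p.coeff i * ((i.descFactorial m : ℝ) * x ^ (i - m)) := by
    conv_lhs => rw [p.as_sum_range_C_mul_X_pow' (Nat.lt_succ_of_le hp)]
    rw [Polynomial.iterate_derivative_sum, eval_finsetSum]
    refine Finset.sum_congr rfl fun i _ => ?_
    rw [iterate_derivative_C_mul, iterate_derivative_X_pow_eq_natCast_mul]
    simp
  rw [hsum]
  calc _ ≤ ∑ i ∈ Finset.range (k+1), |p.coeff i * ((i.descFactorial m : ℝ) * x ^ (i - m))| :=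
        Finset.abs_sum_le_sum_abs _ _
    _ ≤ ∑ i ∈ Finset.range (k+1), (k.factorial * B) := by
        refine Finset.sum_le_sum fun i hi => ?_
        have h1 : (i.descFactorial m : ℝ) ≤ k.factorial := by
          exact_mod_cast descFactorial_le_factorial_of_le
            (Nat.lt_succ_iff.mp (Finset.mem_range.mp hi))
        have h2 : x ^ (i - m) ≤ 1 := pow_le_one₀ hx.1 hx.2
        have h3 : 0 ≤ x ^ (i - m) := pow_nonneg hx.1 _
        rw [abs_mul, abs_of_nonneg (mul_nonneg (Nat.cast_nonneg _) h3)]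
        calc |p.coeff i| * ((i.descFactorial m : ℝ) * x ^ (i - m))
            ≤ B * (k.factorial * 1) := by
              gcongr
              exact hB i
          _ = _ := by ring
    _ = _ := by simp

theorem iterate_derivative_comp_linear (p : ℝ[X]) (h a : ℝ) (m : ℕ) :
    derivative^[m] (p.comp (C h * X + C a))
      = C (h ^ m) * (derivative^[m] p).comp (C h * X + C a) := by
  induction m with
  | zero => simp
  | succ m ih =>
    rw [Function.iterate_succ_apply', ih, Function.iterate_succ_apply', derivative_mul,
      derivative_comp]
    simp only [derivative_C, zero_mul, zero_add, derivative_add, derivative_mul, derivative_X,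
      mul_one, add_zero, pow_succ, C_mul]
    ring

/-- Scaled inverse inequality with the weight `b - x`. -/
theorem exists_weighted_inverse_ineq (k : ℕ) : ∃ K : ℝ, 0 < K ∧ ∀ a b : ℝ, a < b →
    ∀ p : ℝ[X], p.natDegree ≤ k → ∀ m : ℕ, ∀ x ∈ Set.Icc a b,
      ((b - a) ^ m * (derivative^[m] p).eval x) ^ 2 * (b - a) ^ 2
        ≤ K * ∫ x in a..b, (b - x) * p.eval x ^ 2 := by
  obtain ⟨K, hK, hKb⟩ := exists_coeff_sq_le k
  refine ⟨((k + 1) * k.factorial) ^ 2 * K, by positivity, ?_⟩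
  intro a b hab p hp m x hx
  set h := b - a with hh
  have hpos : 0 < h := sub_pos.mpr hab
  set q : ℝ[X] := p.comp (C h * X + C a) with hq
  have hqd : q.natDegree ≤ k := by
    refine natDegree_comp_le.trans ?_
    calc p.natDegree * (C h * X + C a).natDegree ≤ k * 1 :=
          Nat.mul_le_mul hp (natDegree_linear_le)
      _ = k := mul_one k
  set y := (x - a) / h with hy
  have hyx : h * y + a = x := by
    rw [hy]
    field_simp
    ring
  have hy01 : y ∈ Set.Icc (0:ℝ) 1 := by
    constructor
    · exact div_nonneg (by linarith [hx.1]) hpos.le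
    · rw [hy, div_le_one hpos]
      linarith [hx.2]
  have hder : (derivative^[m] q).eval y = h ^ m * (derivative^[m] p).eval x := by
    rw [hq, iterate_derivative_comp_linear]
    simp [eval_comp, hyx]
  set I := ∫ x in (0:ℝ)..1, (1 - x) * q.eval x ^ 2 with hI
  have hIs : h ^ 2 * I = ∫ x in a..b, (b - x) * p.eval x ^ 2 := by
    have := intervalIntegral.smul_integral_comp_mul_add (a := 0) (b := 1)
      (fun x => (b - x) * p.eval x ^ 2) h a
    have hb : h * 1 + a = b := by rw [hh]; ring
    rw [mul_zero, zero_add, hb, smul_eq_mul] at this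
    rw [← this, hI, ← intervalIntegral.integral_const_mul,
      ← intervalIntegral.integral_const_mul]
    apply intervalIntegral.integral_congr
    intro z _
    simp only [hq, eval_comp, eval_add, eval_mul, eval_C, eval_X]
    rw [show b = h + a by rw [hh]; ring]
    ring
  have hI0 : 0 ≤ I := intervalIntegral.integral_nonneg zero_le_one fun z hz =>
    mul_nonneg (by linarith [hz.2]) (sq_nonneg _)
  have hco : ∀ i, |q.coeff i| ≤ Real.sqrt (K * I) := fun i =>
    Real.abs_le_sqrt (hKb q hqd i)
  have hb := abs_eval_iterate_derivative_le hqd m hy01 hco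
  rw [hder] at hb
  have h2 : (h ^ m * (derivative^[m] p).eval x) ^ 2
      ≤ ((k + 1) * (k.factorial * Real.sqrt (K * I))) ^ 2 := by
    rw [← sq_abs]
    exact pow_le_pow_left₀ (abs_nonneg _) hb 2
  rw [← hIs]
  calc _ ≤ ((k + 1) * (k.factorial * Real.sqrt (K * I))) ^ 2 * h ^ 2 := by gcongr
    _ = ((k + 1) * k.factorial) ^ 2 * (Real.sqrt (K * I)) ^ 2 * h ^ 2 := by ring
    _ = _ := by
      rw [Real.sq_sqrt (by positivity)]
      ring

/-- Scaled inverse inequality. -/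
theorem exists_inverse_ineq (k : ℕ) : ∃ K : ℝ, 0 < K ∧ ∀ a b : ℝ, a < b →
    ∀ p : ℝ[X], p.natDegree ≤ k → ∀ m : ℕ, ∀ x ∈ Set.Icc a b,
      (b - a) ^ m * |(derivative^[m] p).eval x| * Real.sqrt (b - a)
        ≤ K * Real.sqrt (∫ x in a..b, p.eval x * p.eval x) := by
  obtain ⟨K, hK, hKb⟩ := exists_weighted_inverse_ineq k
  refine ⟨Real.sqrt K, Real.sqrt_pos.mpr hK, ?_⟩
  intro a b hab p hp m x hx
  have hpos : 0 < b - a := sub_pos.mpr hab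
  rw [← Real.sqrt_mul hK.le]
  apply Real.le_sqrt_of_sq_le
  have h1 := hKb a b hab p hp m x hx
  have h2 : ∫ x in a..b, (b - x) * p.eval x ^ 2
      ≤ (b - a) * ∫ x in a..b, p.eval x * p.eval x := by
    rw [← intervalIntegral.integral_const_mul]
    apply intervalIntegral.integral_mono_on hab.le
    · exact Continuous.intervalIntegrable (by fun_prop) _ _
    · exact Continuous.intervalIntegrable (by fun_prop) _ _
    · intro y hy
      rw [← sq]
      exact mul_le_mul_of_nonneg_right (by linarith [hy.1]) (sq_nonneg _)
  rw [mul_pow, mul_pow, sq_abs, ← mul_pow, Real.sq_sqrt hpos.le]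
  have h3 := h1.trans (mul_le_mul_of_nonneg_left h2 hK.le)
  refine le_of_mul_le_mul_right ?_ hpos
  calc _ = ((b - a) ^ m * (derivative^[m] p).eval x) ^ 2 * (b - a) ^ 2 := by ring
    _ ≤ _ := h3
    _ = _ := by ring

theorem abs_le_of_iteratedDeriv_eq_zero {a b M : ℝ} (n : ℕ) :
    ∀ {f : ℝ → ℝ}, ContDiff ℝ (⊤ : ℕ∞) f → (∀ i < n, iteratedDeriv i f a = 0) →
      (∀ x ∈ Set.Icc a b, |iteratedDeriv n f x| ≤ M) →
      ∀ x ∈ Set.Icc a b, |f x| ≤ M * (b - a) ^ n := by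
  induction n with
  | zero =>
    intro f _ _ h x hx
    simpa using h x hx
  | succ n ih =>
    intro f hf h0 h x hx
    have hf' := contDiff_infty_iff_deriv.mp hf
    have h1 : ∀ x ∈ Set.Icc a b, |deriv f x| ≤ M * (b - a) ^ n := by
      apply ih hf'.2
      · intro i hi
        rw [← iteratedDeriv_succ']
        exact h0 (i+1) (by omega)
      · intro y hy
        rw [← iteratedDeriv_succ']
        exact h y hy
    have ha : a ∈ Set.Icc a b := ⟨le_rfl, hx.1.trans hx.2⟩
    have h2 := Convex.norm_image_sub_le_of_norm_deriv_le (fun y _ => hf'.1 y) h1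
      (convex_Icc a b) ha hx
    have hfa : f a = 0 := by simpa using h0 0 (by omega)
    rw [hfa, sub_zero, Real.norm_eq_abs, Real.norm_eq_abs,
      abs_of_nonneg (sub_nonneg.mpr hx.1)] at h2
    refine h2.trans ?_
    rw [pow_succ, ← mul_assoc]
    exact mul_le_mul_of_nonneg_left (by linarith [hx.2]) ((abs_nonneg _).trans (h1 a ha))

theorem exists_taylor_poly (k : ℕ) (W : ℝ → ℝ) (a : ℝ) : ∃ T : ℝ[X], T.natDegree ≤ k ∧
    ∀ m ≤ k, (derivative^[m] T).eval a = iteratedDeriv m W a := by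
  set S : ℝ[X] := ∑ i ∈ Finset.range (k+1),
    C (iteratedDeriv i W a / i.factorial) * X ^ i with hS
  refine ⟨taylor (-a) S, ?_, ?_⟩
  · rw [natDegree_taylor]
    refine natDegree_sum_le_of_forall_le _ _ fun i hi => ?_
    exact (natDegree_C_mul_X_pow_le _ _).trans (Nat.lt_succ_iff.mp (Finset.mem_range.mp hi))
  · intro m hm
    have h1 : (taylor a (taylor (-a) S)).coeff m = iteratedDeriv m W a / m.factorial := by
      rw [taylor_taylor, add_neg_cancel, taylor_zero, hS]
      simp only [finsetSum_coeff, coeff_C_mul, coeff_X_pow, mul_ite, mul_one, mul_zero]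
      rw [Finset.sum_ite_eq, if_pos (Finset.mem_range.mpr (by omega))]
    rw [taylor_coeff] at h1
    rw [← factorial_smul_hasseDeriv]
    have hm0 : (m.factorial : ℝ) ≠ 0 := by positivity
    rw [LinearMap.smul_apply, eval_smul, h1, nsmul_eq_mul]
    field_simp

theorem iteratedDeriv_eval (p : ℝ[X]) (m : ℕ) :
    iteratedDeriv m (fun x => p.eval x) = fun x => (derivative^[m] p).eval x := by
  induction m with
  | zero => simp
  | succ m ih =>
    rw [iteratedDeriv_succ, ih, Function.iterate_succ_apply']
    funext x
    exact Polynomial.deriv _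

theorem contDiff_eval (p : ℝ[X]) : ContDiff ℝ (⊤ : ℕ∞) (fun x => p.eval x) :=
  by simpa using Polynomial.contDiff_aeval (𝕜 := ℝ) p (⊤ : ℕ∞)

/-- `L∞` stability of the Gauss–Radau conditions on polynomials. -/
theorem exists_gaussRadau_stability (k : ℕ) : ∃ K : ℝ, 0 < K ∧ ∀ a b : ℝ, a < b →
    ∀ g : ℝ → ℝ, Continuous g → ∀ G : ℝ, (∀ x ∈ Set.Icc a b, |g x| ≤ G) →
    ∀ e : ℝ[X], IsGRProj k a b g e → ∀ x ∈ Set.Icc a b, |e.eval x| ≤ K * G := by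
  obtain ⟨K, hK, hKb⟩ := exists_weighted_inverse_ineq k
  refine ⟨1 + 2 * K, by positivity, ?_⟩
  rintro a b hab g hg G hG e ⟨hdeg, horth, heb⟩ x hx
  have hbI : b ∈ Set.Icc a b := ⟨hab.le, le_rfl⟩
  have hG0 : 0 ≤ G := (abs_nonneg _).trans (hG b hbI)
  have hebG : |e.eval b| ≤ G := by rw [heb]; exact hG b hbI
  rcases Nat.eq_zero_or_pos k with hk | hk
  · have hconst : e.eval x = e.eval b := by
      rw [eq_C_of_natDegree_le_zero (p := e) (hk ▸ hdeg), eval_C, eval_C]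
    rw [hconst]
    nlinarith
  have hpos : 0 < b - a := sub_pos.mpr hab
  set r : ℝ[X] := (e - C (e.eval b)) /ₘ (X - C b) with hr
  have hfac : (X - C b) * r = e - C (e.eval b) := by
    rw [hr, mul_divByMonic_eq_iff_isRoot]
    simp
  have hrdeg : r.natDegree < k := by
    rw [hr, natDegree_divByMonic _ (monic_X_sub_C b), natDegree_X_sub_C]
    have : (e - C (e.eval b)).natDegree ≤ k := by
      rw [natDegree_sub_C]
      exact hdeg
    omega
  have hev : ∀ y, e.eval y = e.eval b - (b - y) * r.eval y := by
    intro y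
    have := congrArg (eval y) hfac
    simp only [eval_mul, eval_sub, eval_X, eval_C] at this
    linarith
  have hrc : ContinuousOn (fun y => |r.eval y|) (Set.Icc a b) :=
    Continuous.continuousOn (by fun_prop)
  obtain ⟨x₀, hx₀, hmax⟩ := isCompact_Icc.exists_isMaxOn ⟨b, hbI⟩ hrc
  set R := |r.eval x₀| with hR
  have hRb : ∀ y ∈ Set.Icc a b, |r.eval y| ≤ R := fun y hy => hmax hy
  have hR0 : 0 ≤ R := abs_nonneg _
  have hI : ∫ y in a..b, (b - y) * r.eval y ^ 2 ≤ 2 * G * R * (b - a) := by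
    have h1 : ∫ y in a..b, (b - y) * r.eval y ^ 2
        = ∫ y in a..b, (e.eval b - g y) * r.eval y := by
      have h0 := horth r hrdeg
      rw [← sub_eq_zero, ← intervalIntegral.integral_sub]
      · rw [← h0]
        apply intervalIntegral.integral_congr
        intro y _
        simp only
        rw [hev y]
        ring
      all_goals exact Continuous.intervalIntegrable (by fun_prop) _ _
    rw [h1]
    have h2 := intervalIntegral.norm_integral_le_of_norm_le_const (a := a) (b := b)
      (f := fun y => (e.eval b - g y) * r.eval y) (C := 2 * G * R) (by
        intro y hy
        rw [Set.uIoc_of_le hab.le] at hy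
        have hy' : y ∈ Set.Icc a b := ⟨hy.1.le, hy.2⟩
        rw [Real.norm_eq_abs, abs_mul]
        have h3 : |e.eval b - g y| ≤ 2 * G := by
          have := abs_sub (e.eval b) (g y)
          linarith [hG y hy']
        exact mul_le_mul h3 (hRb y hy') (abs_nonneg _) (by positivity))
    rw [abs_of_pos hpos] at h2
    exact (le_abs_self _).trans h2
  have hRh : R * (b - a) ≤ 2 * K * G := by
    have h1 := hKb a b hab r (by omega) 0 x₀ hx₀
    simp only [pow_zero, one_mul, Function.iterate_zero, id_eq] at h1
    rw [← sq_abs (r.eval x₀), ← hR] at h1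
    have h2 := h1.trans (mul_le_mul_of_nonneg_left hI hK.le)
    rcases hR0.eq_or_lt with h0 | h0
    · rw [← h0, zero_mul]
      positivity
    · refine le_of_mul_le_mul_left ?_ (mul_pos h0 hpos)
      linarith
  rw [hev x]
  have h4 : |(b - x) * r.eval x| ≤ R * (b - a) := by
    rw [abs_mul, mul_comm, abs_of_nonneg (sub_nonneg.mpr hx.2)]
    exact mul_le_mul (hRb x hx) (by linarith [hx.1]) (by linarith [hx.2]) hR0
  have := abs_sub (e.eval b) ((b - x) * r.eval x)
  linarith

/-- Approximation property of the Gauss–Radau projection, including derivatives. -/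
theorem exists_gaussRadau_approx (k : ℕ) : ∃ K : ℝ, 0 < K ∧ ∀ a b : ℝ, a < b →
    ∀ W : ℝ → ℝ, ContDiff ℝ (⊤ : ℕ∞) W → ∀ M : ℝ,
    (∀ x, |iteratedDeriv (k+1) W x| ≤ M) →
    ∀ p : ℝ[X], IsGRProj k a b W p → ∀ m ≤ k, ∀ x ∈ Set.Icc a b,
      (b - a) ^ m * |(derivative^[m] p).eval x - iteratedDeriv m W x|
        ≤ K * M * (b - a) ^ (k+1) := by
  obtain ⟨K₁, hK₁, hinv⟩ := exists_inverse_ineq k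
  obtain ⟨K₂, hK₂, hstab⟩ := exists_gaussRadau_stability k
  refine ⟨K₁ * K₂ + 1, by positivity, ?_⟩
  rintro a b hab W hW M hM p ⟨hdeg, horth, hpb⟩ m hm x hx
  have hpos : 0 < b - a := sub_pos.mpr hab
  have hM0 : 0 ≤ M := (abs_nonneg _).trans (hM 0)
  obtain ⟨T, hTdeg, hT⟩ := exists_taylor_poly k W a
  have hTW : ∀ m ≤ k, ∀ x ∈ Set.Icc a b,
      |iteratedDeriv m W x - (derivative^[m] T).eval x| ≤ M * (b - a) ^ (k + 1 - m) := by
    intro m hm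
    have hg : ContDiff ℝ (⊤ : ℕ∞) (W - fun x => T.eval x) := hW.sub (contDiff_eval T)
    have hgi : ∀ i x, iteratedDeriv i (W - fun x => T.eval x) x
        = iteratedDeriv i W x - (derivative^[i] T).eval x := by
      intro i x
      rw [iteratedDeriv_sub (hW.contDiffAt.of_le (by exact_mod_cast le_top))
        ((contDiff_eval T).contDiffAt.of_le (by exact_mod_cast le_top)), iteratedDeriv_eval]
    have hit : ∀ i, iteratedDeriv i (iteratedDeriv m (W - fun x => T.eval x))
        = iteratedDeriv (i + m) (W - fun x => T.eval x) := by
      intro i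
      simp only [iteratedDeriv_eq_iterate]
      rw [← Function.iterate_add_apply]
    have hsm : ContDiff ℝ (⊤ : ℕ∞) (iteratedDeriv m (W - fun x => T.eval x)) := by
      rw [iteratedDeriv_eq_iterate]
      exact hg.iterate_deriv m
    intro x hx
    rw [← hgi]
    refine abs_le_of_iteratedDeriv_eq_zero (a := a) (k + 1 - m) hsm ?_ ?_ x hx
    · intro i hi
      rw [hit, hgi, hT _ (by omega), sub_self]
    · intro y _
      rw [hit, hgi, Nat.sub_add_cancel (by omega),
        iterate_derivative_eq_zero (by omega : T.natDegree < k + 1), eval_zero, sub_zero]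
      exact hM y
  set G := M * (b - a) ^ (k + 1) with hG
  have hG0 : 0 ≤ G := by positivity
  have hWc : Continuous W := hW.continuous
  have he : ∀ y ∈ Set.Icc a b, |(p - T).eval y| ≤ K₂ * G := by
    apply hstab a b hab (fun y => W y - T.eval y) (by fun_prop) G
    · intro y hy
      simpa using hTW 0 (by omega) y hy
    · refine ⟨natDegree_sub_le_of_le hdeg hTdeg |>.trans (by simp), ?_, ?_⟩
      · intro q hq
        rw [← horth q hq]
        apply intervalIntegral.integral_congr
        intro y _
        simp only [eval_sub]
        ring
      · simp [hpb]
  have hL2 : Real.sqrt (∫ y in a..b, (p - T).eval y * (p - T).eval y)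
      ≤ K₂ * G * Real.sqrt (b - a) := by
    apply Real.sqrt_le_iff.mpr
    refine ⟨by positivity, ?_⟩
    rw [mul_pow, Real.sq_sqrt hpos.le]
    calc _ ≤ ∫ y in a..b, (K₂ * G) ^ 2 := by
          apply intervalIntegral.integral_mono_on hab.le
          · exact Continuous.intervalIntegrable (by fun_prop) _ _
          · exact Continuous.intervalIntegrable (by fun_prop) _ _
          · intro y hy
            rw [← sq, ← sq_abs]
            exact pow_le_pow_left₀ (abs_nonneg _) (he y hy) 2
      _ = _ := by
          rw [intervalIntegral.integral_const, smul_eq_mul]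
          ring
  have h1 : (b - a) ^ m * |(derivative^[m] (p - T)).eval x| ≤ K₁ * (K₂ * G) := by
    refine le_of_mul_le_mul_right ?_ (Real.sqrt_pos.mpr hpos)
    refine (hinv a b hab (p - T)
      (natDegree_sub_le_of_le hdeg hTdeg |>.trans (by simp)) m x hx).trans ?_
    rw [mul_assoc K₁]
    exact mul_le_mul_of_nonneg_left hL2 hK₁.le
  have h2 : (b - a) ^ m * |iteratedDeriv m W x - (derivative^[m] T).eval x| ≤ G := by
    calc _ ≤ (b - a) ^ m * (M * (b - a) ^ (k + 1 - m)) :=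
          mul_le_mul_of_nonneg_left (hTW m hm x hx) (by positivity)
      _ = M * ((b - a) ^ m * (b - a) ^ (k + 1 - m)) := by ring
      _ = G := by rw [← pow_add, Nat.add_sub_cancel' (by omega)]
  have h3 : (derivative^[m] p).eval x - iteratedDeriv m W x
      = (derivative^[m] (p - T)).eval x - (iteratedDeriv m W x - (derivative^[m] T).eval x) := by
    rw [iterate_derivative_sub, eval_sub]
    ring
  rw [h3]
  calc _ ≤ (b - a) ^ m * (|(derivative^[m] (p - T)).eval x|
        + |iteratedDeriv m W x - (derivative^[m] T).eval x|) :=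
        mul_le_mul_of_nonneg_left (abs_sub _ _) (by positivity)
    _ ≤ K₁ * (K₂ * G) + G := by linarith
    _ = _ := by rw [hG]; ring

/-! ### The cellwise inner product and the damping operator -/

section Cell

variable {pt : Fin (N+1) → ℝ}

theorem IsMesh.ptL_lt_ptR (hm : IsMesh pt) (j : Fin N) : ptL pt j < ptR pt j :=
  hm.2.2 (Fin.castSucc_lt_succ)

theorem IsMesh.cellh_pos (hm : IsMesh pt) (j : Fin N) : 0 < cellh pt j :=
  sub_pos.mpr (hm.ptL_lt_ptR j)

theorem cip_comm (j : Fin N) (p q : ℝ[X]) : cip pt j p q = cip pt j q p := by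
  unfold cip
  simp only [mul_comm]

theorem cip_add_left (j : Fin N) (p q v : ℝ[X]) :
    cip pt j (p + q) v = cip pt j p v + cip pt j q v := by
  unfold cip
  rw [← intervalIntegral.integral_add]
  · simp only [eval_add, add_mul]
  all_goals exact Continuous.intervalIntegrable (by fun_prop) _ _

theorem cip_sub_left (j : Fin N) (p q v : ℝ[X]) :
    cip pt j (p - q) v = cip pt j p v - cip pt j q v := by
  unfold cip
  rw [← intervalIntegral.integral_sub]
  · simp only [eval_sub, sub_mul]
  all_goals exact Continuous.intervalIntegrable (by fun_prop) _ _

theorem cip_C_mul_left (j : Fin N) (a : ℝ) (p v : ℝ[X]) :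
    cip pt j (C a * p) v = a * cip pt j p v := by
  unfold cip
  rw [← intervalIntegral.integral_const_mul]
  simp only [eval_mul, eval_C, mul_assoc]

theorem cip_zero_left (j : Fin N) (v : ℝ[X]) : cip pt j 0 v = 0 := by
  simp [cip]

theorem cip_add_right (j : Fin N) (p q v : ℝ[X]) :
    cip pt j v (p + q) = cip pt j v p + cip pt j v q := by
  rw [cip_comm, cip_add_left, cip_comm j p, cip_comm j q]

theorem cip_sum_left {ι : Type*} (s : Finset ι) (f : ι → ℝ[X]) (j : Fin N) (v : ℝ[X]) :
    cip pt j (∑ i ∈ s, f i) v = ∑ i ∈ s, cip pt j (f i) v := by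
  classical
  induction s using Finset.induction_on with
  | empty => simp [cip_zero_left]
  | insert a s ha ih => rw [Finset.sum_insert ha, cip_add_left, ih, Finset.sum_insert ha]

theorem cip_sum_right {ι : Type*} (s : Finset ι) (f : ι → ℝ[X]) (j : Fin N) (v : ℝ[X]) :
    cip pt j v (∑ i ∈ s, f i) = ∑ i ∈ s, cip pt j v (f i) := by
  rw [cip_comm, cip_sum_left]
  simp only [cip_comm j v]

theorem cip_self_nonneg (hm : IsMesh pt) (j : Fin N) (p : ℝ[X]) : 0 ≤ cip pt j p p :=
  intervalIntegral.integral_nonneg (hm.ptL_lt_ptR j).le fun _ _ => mul_self_nonneg _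

theorem cl2_nonneg (j : Fin N) (p : ℝ[X]) : 0 ≤ cl2 pt j p := Real.sqrt_nonneg _

theorem cl2_sq (hm : IsMesh pt) (j : Fin N) (p : ℝ[X]) : cl2 pt j p ^ 2 = cip pt j p p :=
  Real.sq_sqrt (cip_self_nonneg hm j p)

theorem abs_integral_mul_eval_le (hm : IsMesh pt) (j : Fin N) {f : ℝ → ℝ} (hf : Continuous f)
    (v : ℝ[X]) : |∫ x in (ptL pt j)..(ptR pt j), f x * v.eval x|
      ≤ Real.sqrt (∫ x in (ptL pt j)..(ptR pt j), f x ^ 2) * cl2 pt j v := by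
  refine (abs_integral_mul_le (hm.ptL_lt_ptR j).le hf v.continuous).trans_eq ?_
  simp only [cl2, cip, sq]

theorem abs_cip_le (hm : IsMesh pt) (j : Fin N) (p q : ℝ[X]) :
    |cip pt j p q| ≤ cl2 pt j p * cl2 pt j q := by
  refine (abs_integral_mul_eval_le hm j p.continuous q).trans_eq ?_
  simp only [cl2, cip, sq]

theorem eq_zero_of_cip_self (hm : IsMesh pt) {j : Fin N} {p : ℝ[X]} (h : cip pt j p p = 0) :
    p = 0 := by
  by_contra hp
  obtain ⟨x, hx, hxr⟩ : ∃ x ∈ Set.Ioo (ptL pt j) (ptR pt j), p.eval x ≠ 0 := by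
    by_contra! hcon
    exact hp (Polynomial.eq_zero_of_infinite_isRoot p
      ((Set.Ioo_infinite (hm.ptL_lt_ptR j)).mono fun x hx => hcon x hx))
  have : 0 < cip pt j p p := by
    apply intervalIntegral.integral_pos (hm.ptL_lt_ptR j)
    · exact Continuous.continuousOn (by fun_prop)
    · intro y _
      exact mul_self_nonneg _
    · exact ⟨x, ⟨hx.1.le, hx.2.le⟩, mul_self_pos.mpr hxr⟩
  exact this.ne' h

theorem cl2_le_of_cip_le (hm : IsMesh pt) {j : Fin N} {p : ℝ[X]} {B : ℝ} (hB : 0 ≤ B)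
    (h : cip pt j p p ≤ B * cl2 pt j p) : cl2 pt j p ≤ B := by
  rw [← cl2_sq hm] at h
  rcases (cl2_nonneg (pt := pt) j p).eq_or_lt with h0 | h0
  · rwa [← h0]
  · exact le_of_mul_le_mul_right (by rwa [← sq]) h0

theorem cl2_sub_le (hm : IsMesh pt) (j : Fin N) (p q : ℝ[X]) :
    cl2 pt j (p - q) ≤ cl2 pt j p + cl2 pt j q := by
  apply cl2_le_of_cip_le hm (add_nonneg (cl2_nonneg _ _) (cl2_nonneg _ _))
  rw [cip_sub_left, add_mul]
  have h1 := (abs_le.mp (abs_cip_le hm j p (p - q))).2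
  have h2 := (abs_le.mp (abs_cip_le hm j q (p - q))).1
  linarith

variable {Pc : Fin N → ℕ → Polynomial ℝ → Polynomial ℝ}

theorem IsCellProj.cl2_le (hm : IsMesh pt) (hP : IsCellProj pt Pc) (j : Fin N) (d : ℕ)
    (v : ℝ[X]) : cl2 pt j (Pc j d v) ≤ cl2 pt j v := by
  apply cl2_le_of_cip_le hm (cl2_nonneg _ _)
  have h := (hP j d v).2 _ (hP j d v).1
  rw [cip_sub_left, sub_eq_zero] at h
  rw [← h]
  exact (le_abs_self _).trans (abs_cip_le hm j _ _)

theorem IsCellProj.eq_self (hm : IsMesh pt) (hP : IsCellProj pt Pc) {j : Fin N} {d : ℕ}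
    {v : ℝ[X]} (hv : v.natDegree ≤ d) : Pc j d v = v := by
  have h := (hP j d v).2 (v - Pc j d v)
    (natDegree_sub_le_of_le hv (hP j d v).1 |>.trans (by simp))
  exact (sub_eq_zero.mp (eq_zero_of_cip_self hm h)).symm

theorem abs_sub_le_of_linear_decay {y : ℝ → ℝ} {c τ : ℝ} (hc : 0 ≤ c) (hτ : 0 ≤ τ)
    (hy : ∀ t, HasDerivAt y (-(c * y t)) t) : |y τ - y 0| ≤ τ * c * |y 0| := by
  have hz : ∀ t, HasDerivAt (fun t => y t * Real.exp (c * t)) 0 t := by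
    intro t
    have h1 : HasDerivAt (fun t => Real.exp (c * t)) (Real.exp (c * t) * (c * 1)) t :=
      ((hasDerivAt_id t).const_mul c).exp
    exact ((hy t).mul h1).congr_deriv (by ring)
  have hconst := is_const_of_deriv_eq_zero (fun t => (hz t).differentiableAt)
    (fun t => (hz t).deriv) τ 0
  have hyt : y τ = y 0 * Real.exp (-(c * τ)) := by
    simp only [mul_zero, Real.exp_zero, mul_one] at hconst
    rw [← hconst, mul_assoc, ← Real.exp_add, add_neg_cancel, Real.exp_zero, mul_one]
  have h1 : Real.exp (-(c * τ)) ≤ 1 := Real.exp_le_one_iff.mpr (by nlinarith)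
  have h2 := Real.add_one_le_exp (-(c * τ))
  rw [hyt, show y 0 * Real.exp (-(c * τ)) - y 0 = y 0 * (Real.exp (-(c * τ)) - 1) by ring,
    abs_mul, mul_comm (|y 0|)]
  apply mul_le_mul_of_nonneg_right _ (abs_nonneg _)
  rw [abs_of_nonpos (by linarith)]
  linarith

/-- Change over a time `τ` under the cellwise damping flow with nonnegative rates. -/
theorem abs_cip_damping_le (hm : IsMesh pt) (hP : IsCellProj pt Pc) (k : ℕ) (j : Fin N)
    {δ : ℕ → ℝ} (hδ : 1 ≤ k → ∀ m, 0 ≤ δ m) {w : ℝ → ℝ[X]}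
    (hw : ∀ t, ∀ v : ℝ[X], v.natDegree ≤ k → HasDerivAt (fun s => cip pt j (w s) v)
      (-(∑ m ∈ Finset.range (k+1), δ m * cip pt j (w t - Pc j (m-1) (w t)) v)) t)
    {τ : ℝ} (hτ : 0 ≤ τ) (q : ℝ) {v : ℝ[X]} (hv : v.natDegree ≤ k) :
    |cip pt j (w τ - w 0) v| ≤ τ * (∑ m ∈ Finset.range (k+1), δ m)
      * (k * (2 * cl2 pt j (w 0 - C q) * cl2 pt j v)) := by
  set Λ := ∑ m ∈ Finset.range (k+1), δ m with hΛ
  set e : ℕ → ℝ[X] := fun i => Pc j (i+1) v - Pc j i v with he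
  have hdec : v = Pc j 0 v + ∑ i ∈ Finset.range k, e i := by
    rw [he, Finset.sum_range_sub (fun i => Pc j i v), hP.eq_self hm hv]
    ring
  have h0 : cip pt j (w τ - w 0) (Pc j 0 v) = 0 := by
    have hd : ∀ t, HasDerivAt (fun s => cip pt j (w s) (Pc j 0 v)) 0 t := by
      intro t
      refine (hw t (Pc j 0 v) ((hP j 0 v).1.trans (Nat.zero_le k))).congr_deriv ?_
      rw [Finset.sum_eq_zero, neg_zero]
      intro m _
      rw [(hP j (m-1) (w t)).2 _ ((hP j 0 v).1.trans (Nat.zero_le _)), mul_zero]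
    rw [cip_sub_left, sub_eq_zero]
    exact is_const_of_deriv_eq_zero (fun t => (hd t).differentiableAt)
      (fun t => (hd t).deriv) τ 0
  have hi : ∀ i ∈ Finset.range k, |cip pt j (w τ - w 0) (e i)|
      ≤ τ * Λ * (2 * cl2 pt j (w 0 - C q) * cl2 pt j v) := by
    intro i hik
    have hik' := Finset.mem_range.mp hik
    have hδ' := hδ (by omega)
    have horth : ∀ p : ℝ[X], p.natDegree ≤ i → cip pt j p (e i) = 0 := by
      intro p hp
      have h1 := (hP j (i+1) v).2 p (by omega)
      have h2 := (hP j i v).2 p hp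
      rw [cip_comm, show e i = (v - Pc j i v) - (v - Pc j (i+1) v) by simp only [he]; ring,
        cip_sub_left, h1, h2, sub_zero]
    have hedeg : (e i).natDegree ≤ i + 1 :=
      natDegree_sub_le_of_le (hP j (i+1) v).1 ((hP j i v).1.trans (Nat.le_succ i))
        |>.trans (by simp)
    set c := ∑ m ∈ Finset.range (k+1), (if m - 1 ≤ i then δ m else 0) with hc
    have hc0 : 0 ≤ c := Finset.sum_nonneg fun m _ => by split_ifs <;> simp [hδ' m]
    have hcΛ : c ≤ Λ := Finset.sum_le_sum fun m _ => by split_ifs <;> simp [hδ' m]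
    have hy : ∀ t, HasDerivAt (fun s => cip pt j (w s) (e i))
        (-(c * cip pt j (w t) (e i))) t := by
      intro t
      refine (hw t (e i) (by omega)).congr_deriv ?_
      rw [hc, Finset.sum_mul]
      congr 1
      refine Finset.sum_congr rfl fun m _ => ?_
      split_ifs with hmi
      · rw [cip_sub_left, horth _ ((hP j (m-1) (w t)).1.trans hmi), sub_zero]
      · rw [(hP j (m-1) (w t)).2 _ (by omega), zero_mul, mul_zero]
    have h1 := abs_sub_le_of_linear_decay hc0 hτ hy
    rw [← cip_sub_left] at h1
    have h2 : cip pt j (w 0) (e i) = cip pt j (w 0 - C q) (e i) := by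
      rw [cip_sub_left, horth (C q) (by simp), sub_zero]
    have h3 : cl2 pt j (e i) ≤ 2 * cl2 pt j v := by
      have := cl2_sub_le hm j (Pc j (i+1) v) (Pc j i v)
      linarith [hP.cl2_le hm j (i+1) v, hP.cl2_le hm j i v]
    refine h1.trans ?_
    rw [h2]
    have h4 : |cip pt j (w 0 - C q) (e i)| ≤ 2 * cl2 pt j (w 0 - C q) * cl2 pt j v := by
      refine (abs_cip_le hm j _ _).trans ?_
      have := mul_le_mul_of_nonneg_left h3 (cl2_nonneg (pt := pt) j (w 0 - C q))
      linarith
    exact mul_le_mul (mul_le_mul_of_nonneg_left hcΛ hτ) h4 (abs_nonneg _)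
      (mul_nonneg hτ (hc0.trans hcΛ))
  conv_lhs => rw [hdec]
  rw [cip_add_right, h0, zero_add, cip_sum_right]
  refine (Finset.abs_sum_le_sum_abs _ _).trans ((Finset.sum_le_sum hi).trans_eq ?_)
  rw [Finset.sum_const, Finset.card_range, nsmul_eq_mul]
  ring

end Cell

/-! ### Global sums over the mesh -/

section Mesh

variable {pt : Fin (N+1) → ℝ}

theorem sum_succ_sub_castSucc (g : Fin (N+1) → ℝ) :
    ∑ j : Fin N, (g j.succ - g j.castSucc) = g (Fin.last N) - g 0 := by
  rw [Finset.sum_sub_distrib]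
  have h1 := Fin.sum_univ_succ g
  have h2 := Fin.sum_univ_castSucc g
  linarith

theorem IsMesh.sum_cellh (hm : IsMesh pt) : ∑ j, cellh pt j = 1 := by
  have := sum_succ_sub_castSucc pt
  rw [hm.1, hm.2.1, sub_zero] at this
  exact this

theorem IsMesh.sum_integral (hm : IsMesh pt) {f : ℝ → ℝ} (hf : Continuous f) :
    ∑ j, ∫ x in (ptL pt j)..(ptR pt j), f x = ∫ x in (0:ℝ)..1, f x := by
  have h := sum_succ_sub_castSucc fun i => ∫ x in (0:ℝ)..(pt i), f x
  simp only [hm.1, hm.2.1, intervalIntegral.integral_same, sub_zero] at h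
  rw [← h]
  refine Finset.sum_congr rfl fun j _ => ?_
  rw [intervalIntegral.integral_interval_sub_left (hf.intervalIntegrable _ _)
    (hf.intervalIntegrable _ _)]
  rfl

theorem cellh_le_meshSize (pt : Fin (N+1) → ℝ) (j : Fin N) : cellh pt j ≤ meshSize pt :=
  le_ciSup (Set.finite_range (cellh pt)).bddAbove j

theorem IsMesh.meshSize_pos [NeZero N] (hm : IsMesh pt) : 0 < meshSize pt :=
  (hm.cellh_pos 0).trans_le (cellh_le_meshSize pt 0)

theorem IsMesh.card_mul_meshSize_le {γ : ℝ} (hm : IsMesh pt) (hq : QuasiUniform pt γ) :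
    N * meshSize pt ≤ γ := by
  have h : ∑ _j : Fin N, meshSize pt ≤ ∑ j : Fin N, γ * cellh pt j :=
    Finset.sum_le_sum fun j _ => hq j
  rwa [← Finset.mul_sum, hm.sum_cellh, mul_one, Finset.sum_const, Finset.card_univ,
    Fintype.card_fin, nsmul_eq_mul] at h

/-- A periodic function takes the same value on both sides of an interface. -/
theorem IsMesh.apply_ptL_add_one [NeZero N] (hm : IsMesh pt) {f : ℝ → ℝ}
    (hf : ∀ x, f (x + 1) = f x) (j : Fin N) : f (ptL pt (j + 1)) = f (ptR pt j) := by
  obtain ⟨n, rfl⟩ : ∃ n, N = n + 1 := ⟨N - 1, (Nat.succ_pred_eq_of_ne_zero (NeZero.ne N)).symm⟩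
  by_cases hj : j = Fin.last n
  · subst hj
    unfold ptL ptR
    rw [Fin.last_add_one, Fin.succ_last, Fin.castSucc_zero, hm.1, hm.2.1, ← hf 0, zero_add]
  · unfold ptL ptR
    congr 2
    apply Fin.ext
    rw [Fin.val_castSucc, Fin.val_succ, Fin.val_add_one, if_neg hj]

theorem IsMesh.apply_ptL [NeZero N] (hm : IsMesh pt) {f : ℝ → ℝ}
    (hf : ∀ x, f (x + 1) = f x) (j : Fin N) : f (ptL pt j) = f (ptR pt (j - 1)) := by
  rw [← hm.apply_ptL_add_one hf, sub_add_cancel]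

theorem l2_nonneg (pt : Fin (N+1) → ℝ) (u : Fin N → ℝ[X]) : 0 ≤ l2 pt u := Real.sqrt_nonneg _

theorem l2_eq (hm : IsMesh pt) (u : Fin N → ℝ[X]) :
    l2 pt u = Real.sqrt (∑ j, cl2 pt j (u j) ^ 2) := by
  simp only [l2, ip, cl2_sq hm]

theorem sum_mul_cl2_le (hm : IsMesh pt) (f : Fin N → ℝ) (v : Fin N → ℝ[X]) :
    ∑ j, f j * cl2 pt j (v j) ≤ Real.sqrt (∑ j, f j ^ 2) * l2 pt v := by
  rw [l2_eq hm]
  exact Real.sum_mul_le_sqrt_mul_sqrt _ _ _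

theorem sum_cl2_mul_cl2_le (hm : IsMesh pt) (u v : Fin N → ℝ[X]) :
    ∑ j, cl2 pt j (u j) * cl2 pt j (v j) ≤ l2 pt u * l2 pt v := by
  refine (sum_mul_cl2_le hm _ v).trans_eq ?_
  rw [← l2_eq hm]

theorem sum_cl2_shift_mul_cl2_le (hm : IsMesh pt) (π : Equiv.Perm (Fin N))
    (u v : Fin N → ℝ[X]) :
    ∑ j, cl2 pt (π j) (u (π j)) * cl2 pt j (v j) ≤ l2 pt u * l2 pt v := by
  refine (sum_mul_cl2_le hm (fun j => cl2 pt (π j) (u (π j))) v).trans_eq ?_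
  rw [l2_eq hm u, Equiv.sum_comp π (fun j => cl2 pt j (u j) ^ 2)]

theorem sum_sqrt_meshSize_mul_cl2_le {γ : ℝ} (hm : IsMesh pt) (hγ : 1 ≤ γ)
    (hq : QuasiUniform pt γ) (hh : 0 ≤ meshSize pt) (v : Fin N → ℝ[X]) :
    ∑ j, Real.sqrt (meshSize pt) * cl2 pt j (v j) ≤ γ * l2 pt v := by
  refine (sum_mul_cl2_le hm (fun _ => Real.sqrt (meshSize pt)) v).trans ?_
  apply mul_le_mul_of_nonneg_right _ (l2_nonneg pt v)
  rw [Finset.sum_const, Finset.card_univ, Fintype.card_fin, nsmul_eq_mul, Real.sq_sqrt hh]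
  apply Real.sqrt_le_iff.mpr
  exact ⟨by linarith, (hm.card_mul_meshSize_le hq).trans (by nlinarith)⟩

theorem abs_ip_le (hm : IsMesh pt) (u v : Fin N → ℝ[X]) :
    |ip pt u v| ≤ l2 pt u * l2 pt v :=
  (Finset.abs_sum_le_sum_abs _ _).trans
    ((Finset.sum_le_sum fun j _ => abs_cip_le hm j _ _).trans (sum_cl2_mul_cl2_le hm u v))

theorem l2_sq (hm : IsMesh pt) (u : Fin N → ℝ[X]) : l2 pt u ^ 2 = ip pt u u :=
  Real.sq_sqrt (Finset.sum_nonneg fun j _ => cip_self_nonneg hm j _)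

theorem l2_le_of_ip_le (hm : IsMesh pt) {u : Fin N → ℝ[X]} {B : ℝ} (hB : 0 ≤ B)
    (h : |ip pt u u| ≤ B * l2 pt u) : l2 pt u ≤ B := by
  have h := (le_abs_self _).trans h
  rw [← l2_sq hm] at h
  rcases (l2_nonneg pt u).eq_or_lt with h0 | h0
  · rwa [← h0]
  · exact le_of_mul_le_mul_right (by rwa [← sq]) h0

theorem abs_eval_sub_le_linfSub (pt : Fin (N+1) → ℝ) (u : Fin N → ℝ[X]) (c : ℝ) (j : Fin N)
    {x : ℝ} (hx : x ∈ Set.Icc (ptL pt j) (ptR pt j)) :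
    |(u j).eval x - c| ≤ linfSub pt u c := by
  refine le_trans ?_ (le_ciSup (f := fun j : Fin N =>
    sSup ((fun x => |(u j).eval x - c|) '' Set.Icc (ptL pt j) (ptR pt j)))
    (Set.finite_range _).bddAbove j)
  refine le_csSup ?_ ⟨x, hx, rfl⟩
  exact (isCompact_Icc.image (by fun_prop)).bddAbove

theorem cl2_le_of_abs_le (hm : IsMesh pt) {j : Fin N} {p : ℝ[X]} {B : ℝ} (hB : 0 ≤ B)
    (h : ∀ x ∈ Set.Icc (ptL pt j) (ptR pt j), |p.eval x| ≤ B) :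
    cl2 pt j p ≤ B * Real.sqrt (meshSize pt) := by
  have hj := cellh_le_meshSize pt j
  have hpos := hm.cellh_pos j
  apply Real.sqrt_le_iff.mpr
  refine ⟨by positivity, ?_⟩
  rw [mul_pow, Real.sq_sqrt (by linarith)]
  calc cip pt j p p ≤ ∫ _x in (ptL pt j)..(ptR pt j), B ^ 2 := by
        apply intervalIntegral.integral_mono_on (hm.ptL_lt_ptR j).le
        · exact Continuous.intervalIntegrable (by fun_prop) _ _
        · exact Continuous.intervalIntegrable (by fun_prop) _ _
        · intro y hy
          rw [← sq, ← sq_abs]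
          exact pow_le_pow_left₀ (abs_nonneg _) (h y hy) 2
    _ = B ^ 2 * cellh pt j := by
        rw [intervalIntegral.integral_const, smul_eq_mul, cellh]
        ring
    _ ≤ _ := mul_le_mul_of_nonneg_left hj (sq_nonneg B)

end Mesh

/-! ### Estimate of the damping step -/

/-- `U` is a smooth `1`-periodic function whose derivatives up to order `k+1` are bounded by
`M`. -/
def IsRefFun (k : ℕ) (M : ℝ) (U : ℝ → ℝ) : Prop :=
  ContDiff ℝ (⊤ : ℕ∞) U ∧ (∀ x, U (x + 1) = U x) ∧
    ∀ i ≤ k + 1, ∀ x, |iteratedDeriv i U x| ≤ M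

theorem iteratedDeriv_periodic {U : ℝ → ℝ} (hU : ∀ x, U (x + 1) = U x) (m : ℕ) (x : ℝ) :
    iteratedDeriv m U (x + 1) = iteratedDeriv m U x := by
  have h := iteratedDeriv_comp_add_const m U 1
  have h' : (fun z => U (z + 1)) = U := funext hU
  rw [h'] at h
  exact (congrFun h x).symm

theorem exists_cell_approx (k : ℕ) {γ M : ℝ} (hγ : 1 ≤ γ) (hM : 0 ≤ M) : ∃ C : ℝ, 0 < C ∧
    ∀ (N : ℕ) (pt : Fin (N+1) → ℝ), IsMesh pt → QuasiUniform pt γ →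
    ∀ U : ℝ → ℝ, IsRefFun k M U →
    ∀ Pu : Fin N → ℝ[X], (∀ j, IsGRProj k (ptL pt j) (ptR pt j) U (Pu j)) →
    ∀ w : Fin N → ℝ[X], MemVk k w → ∀ m ≤ k, ∀ i, ∀ x ∈ Set.Icc (ptL pt i) (ptR pt i),
      meshSize pt ^ m * |(pderiv m (w i)).eval x - iteratedDeriv m U x|
        ≤ C * (cl2 pt i (w i - Pu i) / Real.sqrt (meshSize pt) + meshSize pt ^ (k+1)) := by
  obtain ⟨K₁, hK₁, hinv⟩ := exists_inverse_ineq k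
  obtain ⟨K₂, hK₂, happ⟩ := exists_gaussRadau_approx k
  refine ⟨γ ^ (k+1) * (K₁ + K₂ * M), by positivity, ?_⟩
  intro N pt hm hq U hU Pu hPu w hw m hmk i x hx
  have hc := hm.cellh_pos i
  have hch := cellh_le_meshSize pt i
  have hhc := hq i
  set h := meshSize pt with hh
  set c := cellh pt i with hcdef
  have hpos : 0 < h := hc.trans_le hch
  set A := cl2 pt i (w i - Pu i) with hA
  have hA0 : 0 ≤ A := cl2_nonneg _ _
  have hγm : γ ^ m ≤ γ ^ k := pow_le_pow_right₀ hγ hmk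
  have hpow : h ^ m ≤ γ ^ k * c ^ m := by
    calc h ^ m ≤ (γ * c) ^ m := pow_le_pow_left₀ hpos.le hhc m
      _ = γ ^ m * c ^ m := mul_pow _ _ _
      _ ≤ _ := by gcongr
  have h1 : c ^ m * |(derivative^[m] (w i - Pu i)).eval x| ≤ K₁ * (γ * (A / Real.sqrt h)) := by
    have h2 := hinv _ _ (hm.ptL_lt_ptR i) (w i - Pu i)
      (natDegree_sub_le_of_le (hw i) (hPu i).1 |>.trans (by simp)) m x hx
    change c ^ m * _ * Real.sqrt c ≤ K₁ * A at h2
    have hsc : 0 < Real.sqrt c := Real.sqrt_pos.mpr hc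
    have hsh : 0 < Real.sqrt h := Real.sqrt_pos.mpr hpos
    have hs : Real.sqrt h ≤ γ * Real.sqrt c := by
      apply Real.sqrt_le_iff.mpr
      refine ⟨by positivity, ?_⟩
      rw [mul_pow, Real.sq_sqrt hc.le]
      nlinarith [mul_le_mul_of_nonneg_right hγ (by positivity : 0 ≤ γ * c)]
    rw [← le_div_iff₀ hsc] at h2
    refine h2.trans ?_
    rw [mul_div_assoc]
    apply mul_le_mul_of_nonneg_left _ hK₁.le
    rw [div_le_iff₀ hsc, mul_assoc, div_mul_eq_mul_div, ← mul_div_assoc, le_div_iff₀ hsh]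
    nlinarith
  have h2 : c ^ m * |(derivative^[m] (Pu i)).eval x - iteratedDeriv m U x|
      ≤ K₂ * M * h ^ (k+1) := by
    refine (happ _ _ (hm.ptL_lt_ptR i) U hU.1 M (hU.2.2 (k+1) le_rfl) (Pu i) (hPu i) m hmk x
      hx).trans ?_
    apply mul_le_mul_of_nonneg_left _ (by positivity)
    exact pow_le_pow_left₀ hc.le hch _
  have h3 : (pderiv m (w i)).eval x - iteratedDeriv m U x
      = (derivative^[m] (w i - Pu i)).eval x
        + ((derivative^[m] (Pu i)).eval x - iteratedDeriv m U x) := by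
    rw [iterate_derivative_sub, eval_sub]
    unfold pderiv
    ring
  rw [h3]
  have hq0 : 0 ≤ A / Real.sqrt h := by positivity
  calc _ ≤ (γ ^ k * c ^ m) * (|(derivative^[m] (w i - Pu i)).eval x|
        + |(derivative^[m] (Pu i)).eval x - iteratedDeriv m U x|) := by
        gcongr
        exact abs_add_le _ _
    _ = γ ^ k * (c ^ m * |(derivative^[m] (w i - Pu i)).eval x|
        + c ^ m * |(derivative^[m] (Pu i)).eval x - iteratedDeriv m U x|) := by ring
    _ ≤ γ ^ k * (K₁ * (γ * (A / Real.sqrt h)) + γ * (K₂ * M * h ^ (k+1))) := by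
        apply mul_le_mul_of_nonneg_left _ (by positivity)
        exact add_le_add h1 (h2.trans (le_mul_of_one_le_left (by positivity) hγ))
    _ ≤ γ ^ k * (K₁ * (γ * (A / Real.sqrt h)) + γ * (K₂ * M * h ^ (k+1)))
        + γ ^ (k+1) * (K₁ * h ^ (k+1) + K₂ * M * (A / Real.sqrt h)) :=
        le_add_of_nonneg_right (by positivity)
    _ = _ := by ring

theorem IsMesh.jump_le [NeZero N] {pt : Fin (N+1) → ℝ} (hm : IsMesh pt) {k : ℕ} {M : ℝ}
    {U : ℝ → ℝ} (hU : IsRefFun k M U) {w : Fin N → ℝ[X]} {m : ℕ} {H : ℝ} (hH : 0 ≤ H)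
    {B : Fin N → ℝ}
    (hB : ∀ i, ∀ x ∈ Set.Icc (ptL pt i) (ptR pt i),
      H * |(pderiv m (w i)).eval x - iteratedDeriv m U x| ≤ B i) (j : Fin N) :
    H * |jumpD pt w m j| ≤ B j + B (j + 1) := by
  have h1 := hB (j+1) (ptL pt (j+1)) ⟨le_rfl, (hm.ptL_lt_ptR _).le⟩
  have h2 := hB j (ptR pt j) ⟨(hm.ptL_lt_ptR _).le, le_rfl⟩
  rw [hm.apply_ptL_add_one (iteratedDeriv_periodic hU.2.1 m)] at h1
  have h3 : jumpD pt w m j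
      = ((pderiv m (w (j+1))).eval (ptL pt (j+1)) - iteratedDeriv m U (ptR pt j))
        - ((pderiv m (w j)).eval (ptR pt j) - iteratedDeriv m U (ptR pt j)) := by
    unfold jumpD ptL ptR
    ring
  rw [h3]
  calc _ ≤ H * (_ + _) := mul_le_mul_of_nonneg_left (abs_sub _ _) hH
    _ ≤ _ := by
      rw [mul_add]
      linarith

theorem dampRate_nonneg [NeZero N] {k : ℕ} (hk : 1 ≤ k) {pt : Fin (N+1) → ℝ} (hm : IsMesh pt)
    {β : ℝ} (hβ : 0 ≤ β) {w : Fin N → ℝ[X]} (hw : 0 ≤ linfSub pt w (avg pt w)) (m : ℕ)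
    (j : Fin N) : 0 ≤ dampRate k pt (fun _ => β) w m j := by
  have hk' : (1:ℝ) ≤ k := by exact_mod_cast hk
  have hc := hm.cellh_pos j
  have h1 : (0:ℝ) ≤ 2 * k - 1 := by linarith
  unfold dampRate sigma
  split_ifs
  · simp
  · positivity

theorem dampRate_le [NeZero N] {k : ℕ} (hk : 1 ≤ k) {pt : Fin (N+1) → ℝ} (hm : IsMesh pt)
    {β γ c0 : ℝ} (hβ : 0 < β) (hq : QuasiUniform pt γ) (hγ : 1 ≤ γ) (hc0 : 0 < c0)
    {w : Fin N → ℝ[X]} (hw : c0 ≤ linfSub pt w (avg pt w)) {m : ℕ} (hmk : m ≤ k)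
    (j : Fin N) :
    dampRate k pt (fun _ => β) w m j ≤ β * γ * (2 * k + 1) / c0 / meshSize pt *
      (meshSize pt ^ m * |jumpD pt w m (j-1)| + meshSize pt ^ m * |jumpD pt w m j|) := by
  have hk' : (1:ℝ) ≤ k := by exact_mod_cast hk
  have hmk' : (m:ℝ) ≤ k := by exact_mod_cast hmk
  have hc := hm.cellh_pos j
  have hch := cellh_le_meshSize pt j
  have hhc := hq j
  set h := meshSize pt
  set c := cellh pt j
  have hpos : 0 < h := hc.trans_le hch
  set J := |jumpD pt w m (j-1)| + |jumpD pt w m j| with hJ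
  have hJ0 : 0 ≤ J := by positivity
  have hσ : sigma k pt w m j ≤ (2 * k + 1) * h ^ m * (J / c0) := by
    unfold sigma
    split_ifs
    · positivity
    · have hf : (1:ℝ) ≤ (2 * k - 1) * m.factorial := by
        have : (1:ℝ) ≤ m.factorial := by exact_mod_cast Nat.factorial_pos m
        nlinarith
      have hl : 0 < linfSub pt w (avg pt w) := hc0.trans_le hw
      apply mul_le_mul _ _ (div_nonneg hJ0 (by positivity)) (by positivity)
      · rw [div_le_iff₀ (by linarith)]
        refine le_trans ?_ (le_mul_of_one_le_right (by positivity) hf)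
        gcongr
      · apply div_le_div_of_nonneg_left hJ0 hc0
        linarith
  unfold dampRate
  calc β * sigma k pt w m j / cellh pt j
      ≤ β * ((2 * k + 1) * h ^ m * (J / c0)) / c := by
        apply div_le_div_of_nonneg_right _ hc.le
        exact mul_le_mul_of_nonneg_left hσ hβ.le
    _ ≤ β * ((2 * k + 1) * h ^ m * (J / c0)) / (h / γ) := by
        apply div_le_div_of_nonneg_left (by positivity) (by positivity)
        rw [div_le_iff₀ (by linarith)]
        linarith
    _ = _ := by
        rw [hJ]
        field_simp

/-- One damping step changes `u_h` by at most `C τ (‖ξ‖ + h^{k+1})` in `L²`. -/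
theorem exists_damping_estimate (k : ℕ) {β γ c0 M : ℝ} (hβ : 0 < β) (hγ : 1 ≤ γ)
    (hc0 : 0 < c0) (hM : 0 ≤ M) : ∃ C : ℝ, 0 < C ∧
    ∀ (N : ℕ) [NeZero N] (pt : Fin (N+1) → ℝ), IsMesh pt → QuasiUniform pt γ →
      meshSize pt ≤ 1 → ∀ τ : ℝ, 0 < τ →
    ∀ U : ℝ → ℝ, IsRefFun k M U →
    ∀ Pu : Fin N → ℝ[X], (∀ j, IsGRProj k (ptL pt j) (ptR pt j) U (Pu j)) →
    ∀ Pc : Fin N → ℕ → Polynomial ℝ → Polynomial ℝ, IsCellProj pt Pc →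
    ∀ w : Fin N → ℝ[X], MemVk k w → c0 ≤ linfSub pt w (avg pt w) →
      linfSub pt (fun j => w j - Pu j) 0 ≤ meshSize pt →
    ∀ W : ℝ → Fin N → ℝ[X], IsDampingSol k pt (fun _ => β) Pc w W →
    ∀ v : Fin N → ℝ[X], MemVk k v →
      |ip pt (fun j => W τ j - w j) v|
        ≤ τ * (C * (l2 pt (fun j => w j - Pu j) + meshSize pt ^ (k+1))) * l2 pt v := by
  obtain ⟨C₁, hC₁, happ⟩ := exists_cell_approx k hγ hM
  obtain ⟨K₂, hK₂, hgr⟩ := exists_gaussRadau_approx k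
  set C₂ := (k + 1) * (β * γ * (2 * k + 1) / c0 * C₁) with hC₂
  set C₃ := 1 + K₂ * M + M with hC₃
  set C₄ := C₂ * (k * (2 * C₃)) with hC₄
  have hC₂0 : 0 < C₂ := by positivity
  have hC₃0 : 0 < C₃ := by positivity
  have hC₄0 : 0 ≤ C₄ := by positivity
  refine ⟨4 * γ * C₄ + 1, by positivity, ?_⟩
  intro N _ pt hm hq hh1 τ hτ U hU Pu hPu Pc hP w hw hwc hξ W hW v hv
  have hpos := hm.meshSize_pos
  set h := meshSize pt with hh
  set A : Fin N → ℝ := fun j => cl2 pt j (w j - Pu j) with hA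
  have hA0 : ∀ j, 0 ≤ A j := fun j => cl2_nonneg _ _
  have hsh : 0 < Real.sqrt h := Real.sqrt_pos.mpr hpos
  have hosc : ∀ j, cl2 pt j (w j - C (U (ptL pt j))) ≤ C₃ * h * Real.sqrt h := by
    intro j
    have hc := hm.cellh_pos j
    have hch := cellh_le_meshSize pt j
    apply cl2_le_of_abs_le hm (by positivity)
    intro x hx
    have e1 : |(w j - Pu j).eval x| ≤ h := by
      have := abs_eval_sub_le_linfSub pt (fun j => w j - Pu j) 0 j hx
      rw [sub_zero] at this
      exact this.trans hξ
    have e2 : |(Pu j).eval x - U x| ≤ K₂ * M * h := by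
      have := hgr _ _ (hm.ptL_lt_ptR j) U hU.1 M (hU.2.2 (k+1) le_rfl) (Pu j) (hPu j) 0
        (Nat.zero_le k) x hx
      simp only [pow_zero, one_mul, Function.iterate_zero, id_eq, iteratedDeriv_zero] at this
      refine this.trans (mul_le_mul_of_nonneg_left ?_ (by positivity))
      calc (ptR pt j - ptL pt j) ^ (k+1) ≤ h ^ (k+1) := pow_le_pow_left₀ hc.le hch _
        _ ≤ h ^ 1 := pow_le_pow_of_le_one hpos.le hh1 (by omega)
        _ = h := pow_one h
    have e3 : |U x - U (ptL pt j)| ≤ M * h := by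
      have := Convex.norm_image_sub_le_of_norm_deriv_le (s := Set.univ) (C := M) (f := U)
        (fun y _ => (contDiff_infty_iff_deriv.mp hU.1).1 y)
        (fun y _ => by
          have := hU.2.2 1 (by omega) y
          rwa [iteratedDeriv_one] at this) convex_univ (Set.mem_univ (ptL pt j)) (Set.mem_univ x)
      refine this.trans (mul_le_mul_of_nonneg_left ?_ hM)
      rw [Real.norm_eq_abs, abs_of_nonneg (sub_nonneg.mpr hx.1)]
      refine le_trans ?_ hch
      unfold cellh
      linarith [hx.2]
    have e4 : (w j - C (U (ptL pt j))).eval x = (w j - Pu j).eval x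
        + ((Pu j).eval x - U x) + (U x - U (ptL pt j)) := by
      simp only [eval_sub, eval_C]
      ring
    rw [e4]
    refine (abs_add_three _ _ _).trans ?_
    rw [hC₃]
    linarith
  have hrate : 1 ≤ k → ∀ j, ∑ m ∈ Finset.range (k+1), dampRate k pt (fun _ => β) w m j
      ≤ C₂ / h * ((A (j-1) + 2 * A j + A (j+1)) / Real.sqrt h + 4 * h ^ (k+1)) := by
    intro hk j
    calc _ ≤ ∑ m ∈ Finset.range (k+1), β * γ * (2 * k + 1) / c0 / h *
          (C₁ * ((A (j-1) + 2 * A j + A (j+1)) / Real.sqrt h + 4 * h ^ (k+1))) := by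
          refine Finset.sum_le_sum fun m hmr => ?_
          have hmk : m ≤ k := Nat.lt_succ_iff.mp (Finset.mem_range.mp hmr)
          refine (dampRate_le hk hm hβ hq hγ hc0 hwc hmk j).trans ?_
          apply mul_le_mul_of_nonneg_left _ (by positivity)
          have hj := hm.jump_le hU (w := w) (m := m) (pow_nonneg hpos.le m)
            (fun i x hx => happ N pt hm hq U hU Pu hPu w hw m hmk i x hx)
          have h1 := hj (j-1)
          have h2 := hj j
          rw [sub_add_cancel] at h1
          refine (add_le_add h1 h2).trans_eq ?_
          simp only [hA]
          ring
      _ = _ := by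
          rw [Finset.sum_const, Finset.card_range, nsmul_eq_mul, hC₂]
          push_cast
          ring
  have hcell : ∀ j, |cip pt j (W τ j - w j) (v j)|
      ≤ τ * C₄ * (A (j-1) * cl2 pt j (v j) + 2 * (A j * cl2 pt j (v j))
          + A (j+1) * cl2 pt j (v j)
          + 4 * h ^ (k+1) * (Real.sqrt h * cl2 pt j (v j))) := by
    intro j
    have hv0 : 0 ≤ cl2 pt j (v j) := cl2_nonneg _ _
    have h1 := abs_cip_damping_le hm hP k j (δ := fun m => dampRate k pt (fun _ => β) w m j)
      (fun hk m => dampRate_nonneg hk hm hβ.le (hc0.le.trans hwc) m j)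
      (w := fun t => W t j) (fun t v hv => hW.2.2 t j v hv) hτ.le (U (ptL pt j)) (hv j)
    simp only [hW.1] at h1
    rcases Nat.eq_zero_or_pos k with hk | hk
    · rw [hC₄]
      simpa [hk] using h1
    · refine h1.trans ?_
      have hAj := hA0 (j-1)
      have hAj' := hA0 j
      have hAj'' := hA0 (j+1)
      calc _ ≤ τ * (C₂ / h * ((A (j-1) + 2 * A j + A (j+1)) / Real.sqrt h + 4 * h ^ (k+1)))
            * (k * (2 * (C₃ * h * Real.sqrt h) * cl2 pt j (v j))) := by
            gcongr
            · exact mul_nonneg (Nat.cast_nonneg k) (mul_nonneg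
                (mul_nonneg zero_le_two (cl2_nonneg _ _)) hv0)
            · exact hrate hk j
            · exact hosc j
        _ = _ := by
            rw [hC₄]
            field_simp
  have hl0 := l2_nonneg pt v
  have hs1 := sum_cl2_shift_mul_cl2_le hm (Equiv.subRight (1 : Fin N)) (fun j => w j - Pu j) v
  have hs2 := sum_cl2_shift_mul_cl2_le hm (Equiv.addRight (1 : Fin N)) (fun j => w j - Pu j) v
  have hs3 := sum_cl2_mul_cl2_le hm (fun j => w j - Pu j) v
  have hs4 := sum_sqrt_meshSize_mul_cl2_le hm hγ hq hpos.le v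
  simp only [Equiv.subRight_apply, Equiv.coe_addRight] at hs1 hs2
  set E := l2 pt (fun j => w j - Pu j) with hE
  have hE0 : 0 ≤ E := l2_nonneg _ _
  calc |ip pt (fun j => W τ j - w j) v| ≤ ∑ j, |cip pt j (W τ j - w j) (v j)| :=
        Finset.abs_sum_le_sum_abs _ _
    _ ≤ _ := Finset.sum_le_sum fun j _ => hcell j
    _ = τ * C₄ * (∑ j, A (j-1) * cl2 pt j (v j) + 2 * ∑ j, A j * cl2 pt j (v j)
          + ∑ j, A (j+1) * cl2 pt j (v j)
          + 4 * h ^ (k+1) * ∑ j, Real.sqrt h * cl2 pt j (v j)) := by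
        rw [← Finset.mul_sum, Finset.sum_add_distrib, Finset.sum_add_distrib,
          Finset.sum_add_distrib, ← Finset.mul_sum, ← Finset.mul_sum]
    _ ≤ τ * C₄ * (E * l2 pt v + 2 * (E * l2 pt v) + E * l2 pt v
          + 4 * h ^ (k+1) * (γ * l2 pt v)) := by gcongr
    _ = τ * (C₄ * (4 * E + 4 * γ * h ^ (k+1))) * l2 pt v := by ring
    _ ≤ _ := by
        apply mul_le_mul_of_nonneg_right _ hl0
        apply mul_le_mul_of_nonneg_left _ hτ.le
        have hhk : 0 ≤ h ^ (k+1) := by positivity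
        have h1 : 4 * E + 4 * γ * h ^ (k+1) ≤ 4 * γ * (E + h ^ (k+1)) := by nlinarith
        nlinarith [mul_le_mul_of_nonneg_left h1 hC₄0]

/-! ### Estimate of a Runge–Kutta stage -/

theorem IsDGOp.cip_add_eq [NeZero N] {pt : Fin (N+1) → ℝ} (hm : IsMesh pt) {k : ℕ} {β : ℝ}
    {L : (Fin N → ℝ[X]) → (Fin N → ℝ[X])} (hL : IsDGOp k pt β L) {U : ℝ → ℝ}
    (hU : ContDiff ℝ 1 U) (hper : ∀ x, U (x + 1) = U x) {Pu : Fin N → ℝ[X]}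
    (hPu : ∀ j, IsGRProj k (ptL pt j) (ptR pt j) U (Pu j)) {w : Fin N → ℝ[X]} (hw : MemVk k w)
    (j : Fin N) {v : ℝ[X]} (hv : v.natDegree ≤ k) :
    cip pt j (L w j) v + β * ∫ x in (ptL pt j)..(ptR pt j), deriv U x * v.eval x
      = dgRHS pt β (fun i => w i - Pu i) j v := by
  have hUc : Continuous U := hU.continuous
  have hdc : Continuous (deriv U) := hU.continuous_deriv le_rfl
  rw [(hL w hw).2 j v hv]
  have horth : ∫ x in (ptL pt j)..(ptR pt j), (U x - (Pu j).eval x) * (derivative v).eval x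
      = 0 := by
    rcases Nat.eq_zero_or_pos k with hk | hk
    · rw [derivative_of_natDegree_zero (by omega)]
      simp
    · exact (hPu j).2.1 _ ((natDegree_derivative_le v).trans_lt (by omega))
  have hibp := intervalIntegral.integral_mul_deriv_eq_deriv_mul (a := ptL pt j) (b := ptR pt j)
    (u := U) (v := fun x => v.eval x) (u' := deriv U) (v' := fun x => (derivative v).eval x)
    (fun x _ => (hU.differentiable one_ne_zero x).hasDerivAt) (fun x _ => v.hasDerivAt x)
    (hdc.intervalIntegrable _ _) (Continuous.intervalIntegrable (by fun_prop) _ _)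
  have hsplit : ∫ x in (ptL pt j)..(ptR pt j), (U x - (Pu j).eval x) * (derivative v).eval x
      = (∫ x in (ptL pt j)..(ptR pt j), U x * (derivative v).eval x)
        - ∫ x in (ptL pt j)..(ptR pt j), (Pu j).eval x * (derivative v).eval x := by
    rw [← intervalIntegral.integral_sub]
    · simp only [sub_mul]
    all_goals exact Continuous.intervalIntegrable (by fun_prop) _ _
  have hR := (hPu j).2.2
  have hR' : (Pu (j-1)).eval (pt (j-1).succ) = U (ptL pt j) := by
    rw [hm.apply_ptL hper]
    exact (hPu (j-1)).2.2
  have hlin := cip_sub_left (pt := pt) j (w j) (Pu j) (derivative v)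
  unfold cip at hlin
  unfold dgRHS
  rw [hlin, eval_sub, eval_sub, hR, hR']
  linear_combination β * hibp - β * horth + β * hsplit

theorem exists_dgRHS_le (k : ℕ) {β γ : ℝ} (hβ : 0 < β) (hγ : 1 ≤ γ) : ∃ C : ℝ, 0 < C ∧
    ∀ (N : ℕ) [NeZero N] (pt : Fin (N+1) → ℝ), IsMesh pt → QuasiUniform pt γ →
    ∀ w v : Fin N → ℝ[X], MemVk k w → MemVk k v →
      meshSize pt * |∑ j, dgRHS pt β w j (v j)| ≤ C * (l2 pt w * l2 pt v) := by
  obtain ⟨K, hK, hinv⟩ := exists_inverse_ineq k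
  refine ⟨β * γ * (γ * K + 2 * (K * K) * γ), by positivity, ?_⟩
  intro N _ pt hm hq w v hw hv
  set h := meshSize pt with hh
  have hpos : 0 < h := hm.meshSize_pos
  have hsqrt : ∀ i, √h ≤ γ * √(cellh pt i) := by
    intro i
    have hc := hm.cellh_pos i
    apply Real.sqrt_le_iff.mpr
    refine ⟨by positivity, ?_⟩
    rw [mul_pow, Real.sq_sqrt hc.le]
    nlinarith [hq i, mul_le_mul_of_nonneg_right hγ (by positivity : 0 ≤ γ * cellh pt i)]
  have hpt : ∀ (p : ℝ[X]) (i : Fin N) (x : ℝ), p.natDegree ≤ k →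
      x ∈ Set.Icc (ptL pt i) (ptR pt i) → √h * |p.eval x| ≤ K * γ * cl2 pt i p := by
    intro p i x hp hx
    have h1 := hinv _ _ (hm.ptL_lt_ptR i) p hp 0 x hx
    simp only [pow_zero, one_mul, Function.iterate_zero, id_eq] at h1
    change |p.eval x| * √(cellh pt i) ≤ K * cl2 pt i p at h1
    calc √h * |p.eval x| ≤ γ * √(cellh pt i) * |p.eval x| := by
          gcongr
          exact hsqrt i
      _ = γ * (|p.eval x| * √(cellh pt i)) := by ring
      _ ≤ γ * (K * cl2 pt i p) := by gcongr
      _ = _ := by ring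
  have hder : ∀ (p : ℝ[X]) (i : Fin N), p.natDegree ≤ k →
      h * cl2 pt i (derivative p) ≤ γ * γ * K * cl2 pt i p := by
    intro p i hp
    have hc := hm.cellh_pos i
    have hsh : 0 < √h := Real.sqrt_pos.mpr hpos
    have h0 : 0 ≤ cl2 pt i p := cl2_nonneg _ _
    have h1 : cl2 pt i (derivative p) ≤ γ * γ * K * cl2 pt i p / (h * √h) * √h := by
      apply cl2_le_of_abs_le hm (by positivity)
      intro x hx
      have h1 := hinv _ _ (hm.ptL_lt_ptR i) p hp 1 x hx
      simp only [pow_one, Function.iterate_one] at h1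
      change cellh pt i * _ * √(cellh pt i) ≤ K * cl2 pt i p at h1
      rw [le_div_iff₀ (by positivity)]
      calc |(derivative p).eval x| * (h * √h)
          ≤ |(derivative p).eval x| * ((γ * cellh pt i) * (γ * √(cellh pt i))) := by
            apply mul_le_mul_of_nonneg_left _ (abs_nonneg _)
            exact mul_le_mul (hq i) (hsqrt i) hsh.le (by positivity)
        _ = γ * γ * (cellh pt i * |(derivative p).eval x| * √(cellh pt i)) := by ring
        _ ≤ γ * γ * (K * cl2 pt i p) := by gcongr
        _ = _ := by ring
    calc _ ≤ h * _ := mul_le_mul_of_nonneg_left h1 hpos.le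
      _ = _ := by field_simp
  have hcell : ∀ j, h * |dgRHS pt β w j (v j)|
      ≤ β * (γ * γ * K + K * γ * (K * γ)) * (cl2 pt j (w j) * cl2 pt j (v j))
        + β * (K * γ * (K * γ)) * (cl2 pt (j-1) (w (j-1)) * cl2 pt j (v j)) := by
    intro j
    have hab := (hm.ptL_lt_ptR j).le
    have e1 := abs_cip_le hm j (w j) (derivative (v j))
    have e2 := hder (v j) j (hv j)
    have e3 := hpt (w j) j (ptR pt j) (hw j) ⟨hab, le_rfl⟩
    have e4 := hpt (v j) j (ptR pt j) (hv j) ⟨hab, le_rfl⟩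
    have e5 := hpt (v j) j (ptL pt j) (hv j) ⟨le_rfl, hab⟩
    have e6 := hpt (w (j-1)) (j-1) (ptR pt (j-1)) (hw _) ⟨(hm.ptL_lt_ptR _).le, le_rfl⟩
    have hsq : √h * √h = h := Real.mul_self_sqrt hpos.le
    have n1 := cl2_nonneg (pt := pt) j (w j)
    have n2 := cl2_nonneg (pt := pt) j (v j)
    have n3 := cl2_nonneg (pt := pt) (j-1) (w (j-1))
    have f1 : h * |cip pt j (w j) (derivative (v j))|
        ≤ γ * γ * K * (cl2 pt j (w j) * cl2 pt j (v j)) := by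
      calc _ ≤ h * _ := mul_le_mul_of_nonneg_left e1 hpos.le
        _ = cl2 pt j (w j) * (h * cl2 pt j (derivative (v j))) := by ring
        _ ≤ cl2 pt j (w j) * (γ * γ * K * cl2 pt j (v j)) := by gcongr
        _ = _ := by ring
    have f2 : h * (|(w j).eval (ptR pt j)| * |(v j).eval (ptR pt j)|)
        ≤ K * γ * (K * γ) * (cl2 pt j (w j) * cl2 pt j (v j)) := by
      calc _ = (√h * |(w j).eval (ptR pt j)|) * (√h * |(v j).eval (ptR pt j)|) := by
            linear_combination -(|(w j).eval (ptR pt j)| * |(v j).eval (ptR pt j)|) * hsq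
        _ ≤ (K * γ * cl2 pt j (w j)) * (K * γ * cl2 pt j (v j)) := by
            apply mul_le_mul e3 e4 (by positivity) (by positivity)
        _ = _ := by ring
    have f3 : h * (|(w (j-1)).eval (ptR pt (j-1))| * |(v j).eval (ptL pt j)|)
        ≤ K * γ * (K * γ) * (cl2 pt (j-1) (w (j-1)) * cl2 pt j (v j)) := by
      calc _ = (√h * |(w (j-1)).eval (ptR pt (j-1))|) * (√h * |(v j).eval (ptL pt j)|) := by
            linear_combination -(|(w (j-1)).eval (ptR pt (j-1))| * |(v j).eval (ptL pt j)|) * hsq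
        _ ≤ (K * γ * cl2 pt (j-1) (w (j-1))) * (K * γ * cl2 pt j (v j)) := by
            apply mul_le_mul e6 e5 (by positivity) (by positivity)
        _ = _ := by ring
    have habs : |dgRHS pt β w j (v j)| ≤ β * |cip pt j (w j) (derivative (v j))|
        + β * (|(w j).eval (ptR pt j)| * |(v j).eval (ptR pt j)|)
        + β * (|(w (j-1)).eval (ptR pt (j-1))| * |(v j).eval (ptL pt j)|) := by
      have hrw : dgRHS pt β w j (v j) = β * cip pt j (w j) (derivative (v j))
          + -(β * ((w j).eval (ptR pt j) * (v j).eval (ptR pt j)))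
          + β * ((w (j-1)).eval (ptR pt (j-1)) * (v j).eval (ptL pt j)) := by
        unfold dgRHS cip
        simp only [ptR]
        ring
      rw [hrw]
      refine (abs_add_three _ _ _).trans_eq ?_
      simp only [abs_neg, abs_mul, abs_of_pos hβ]
    calc _ ≤ h * _ := mul_le_mul_of_nonneg_left habs hpos.le
      _ = β * (h * |cip pt j (w j) (derivative (v j))|
          + h * (|(w j).eval (ptR pt j)| * |(v j).eval (ptR pt j)|)
          + h * (|(w (j-1)).eval (ptR pt (j-1))| * |(v j).eval (ptL pt j)|)) := by ring
      _ ≤ β * (γ * γ * K * (cl2 pt j (w j) * cl2 pt j (v j))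
          + K * γ * (K * γ) * (cl2 pt j (w j) * cl2 pt j (v j))
          + K * γ * (K * γ) * (cl2 pt (j-1) (w (j-1)) * cl2 pt j (v j))) :=
          mul_le_mul_of_nonneg_left (add_le_add (add_le_add f1 f2) f3) hβ.le
      _ = _ := by ring
  have hs1 := sum_cl2_shift_mul_cl2_le hm (Equiv.subRight (1 : Fin N)) w v
  have hs2 := sum_cl2_mul_cl2_le hm w v
  simp only [Equiv.subRight_apply] at hs1
  calc _ ≤ h * ∑ j, |dgRHS pt β w j (v j)| :=
        mul_le_mul_of_nonneg_left (Finset.abs_sum_le_sum_abs _ _) hpos.le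
    _ = ∑ j, h * |dgRHS pt β w j (v j)| := Finset.mul_sum _ _ _
    _ ≤ _ := Finset.sum_le_sum fun j _ => hcell j
    _ = β * (γ * γ * K + K * γ * (K * γ)) * (∑ j, cl2 pt j (w j) * cl2 pt j (v j))
        + β * (K * γ * (K * γ)) * ∑ j, cl2 pt (j-1) (w (j-1)) * cl2 pt j (v j) := by
        rw [Finset.sum_add_distrib, ← Finset.mul_sum, ← Finset.mul_sum]
    _ ≤ β * (γ * γ * K + K * γ * (K * γ)) * (l2 pt w * l2 pt v)
        + β * (K * γ * (K * γ)) * (l2 pt w * l2 pt v) := by gcongr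
    _ = _ := by ring

theorem exists_ipF_gaussRadau_le (k : ℕ) {γ M : ℝ} (hγ : 1 ≤ γ) (hM : 0 ≤ M) : ∃ C : ℝ, 0 ≤ C ∧
    ∀ (N : ℕ) [NeZero N] (pt : Fin (N+1) → ℝ), IsMesh pt → QuasiUniform pt γ →
    ∀ U : ℝ → ℝ, IsRefFun k M U →
    ∀ Pu : Fin N → ℝ[X], (∀ j, IsGRProj k (ptL pt j) (ptR pt j) U (Pu j)) →
    ∀ v : Fin N → ℝ[X],
      |ipF pt (fun j x => U x - (Pu j).eval x) v| ≤ C * meshSize pt ^ (k+1) * l2 pt v := by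
  obtain ⟨K, hK, hgr⟩ := exists_gaussRadau_approx k
  refine ⟨K * M * γ, by positivity, ?_⟩
  intro N _ pt hm hq U hU Pu hPu v
  set h := meshSize pt with hh
  have hpos : 0 < h := hm.meshSize_pos
  have hUc : Continuous U := hU.1.continuous
  have hcell : ∀ j, |∫ x in (ptL pt j)..(ptR pt j), (U x - (Pu j).eval x) * (v j).eval x|
      ≤ K * M * h ^ (k+1) * (√h * cl2 pt j (v j)) := by
    intro j
    have hc := hm.cellh_pos j
    have hch := cellh_le_meshSize pt j
    have hab := (hm.ptL_lt_ptR j).le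
    have hfc : Continuous fun x => U x - (Pu j).eval x := by fun_prop
    refine (abs_integral_mul_eval_le hm j hfc (v j)).trans ?_
    rw [← mul_assoc]
    apply mul_le_mul_of_nonneg_right _ (cl2_nonneg _ _)
    have hbd : ∀ x ∈ Set.Icc (ptL pt j) (ptR pt j),
        (U x - (Pu j).eval x) ^ 2 ≤ (K * M * h ^ (k+1)) ^ 2 := by
      intro x hx
      have h1 := hgr _ _ (hm.ptL_lt_ptR j) U hU.1 M (hU.2.2 (k+1) le_rfl) (Pu j) (hPu j) 0
        (Nat.zero_le k) x hx
      simp only [pow_zero, one_mul, Function.iterate_zero, id_eq, iteratedDeriv_zero] at h1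
      rw [abs_sub_comm] at h1
      rw [sq_le_sq, abs_of_nonneg (by positivity : 0 ≤ K * M * h ^ (k+1))]
      refine h1.trans (mul_le_mul_of_nonneg_left ?_ (by positivity))
      exact pow_le_pow_left₀ hc.le hch _
    apply Real.sqrt_le_iff.mpr
    refine ⟨by positivity, ?_⟩
    rw [mul_pow, Real.sq_sqrt hpos.le]
    calc _ ≤ ∫ x in (ptL pt j)..(ptR pt j), (K * M * h ^ (k+1)) ^ 2 :=
          intervalIntegral.integral_mono_on hab
            (Continuous.intervalIntegrable (by fun_prop) _ _) (by simp) hbd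
      _ = (K * M * h ^ (k+1)) ^ 2 * cellh pt j := by
          rw [intervalIntegral.integral_const, smul_eq_mul, mul_comm]
          rfl
      _ ≤ _ := by gcongr
  calc _ ≤ ∑ j, |∫ x in (ptL pt j)..(ptR pt j), (U x - (Pu j).eval x) * (v j).eval x| :=
        Finset.abs_sum_le_sum_abs _ _
    _ ≤ _ := Finset.sum_le_sum fun j _ => hcell j
    _ = K * M * h ^ (k+1) * ∑ j, √h * cl2 pt j (v j) := by rw [Finset.mul_sum]
    _ ≤ K * M * h ^ (k+1) * (γ * l2 pt v) := by
        gcongr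
        exact sum_sqrt_meshSize_mul_cl2_le hm hγ hq hpos.le v
    _ = _ := by ring

theorem abs_ipF_le {pt : Fin (N+1) → ℝ} (hm : IsMesh pt) {f : ℝ → ℝ} (hf : Continuous f)
    (v : Fin N → ℝ[X]) : |ipF pt (fun _ => f) v| ≤ fl2 f * l2 pt v := by
  calc _ ≤ ∑ j, |∫ x in (ptL pt j)..(ptR pt j), f x * (v j).eval x| :=
        Finset.abs_sum_le_sum_abs _ _
    _ ≤ ∑ j, √(∫ x in (ptL pt j)..(ptR pt j), f x ^ 2) * cl2 pt j (v j) :=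
        Finset.sum_le_sum fun j _ => abs_integral_mul_eval_le hm j hf (v j)
    _ ≤ _ := sum_mul_cl2_le hm _ v
    _ = _ := by
        unfold fl2
        rw [← hm.sum_integral (f := fun x => f x ^ 2) (by fun_prop)]
        congr 2
        refine Finset.sum_congr rfl fun j _ => Real.sq_sqrt ?_
        exact intervalIntegral.integral_nonneg (hm.ptL_lt_ptR j).le fun x _ => sq_nonneg _

theorem cip_rkStage_sub_eq [NeZero N] {pt : Fin (N+1) → ℝ} (hm : IsMesh pt) {k ℓ : ℕ}
    {c d : ℕ → ℕ → ℝ} {β τ : ℝ}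
    {L : (Fin N → ℝ[X]) → (Fin N → ℝ[X])} (hL : IsDGOp k pt β L) {U : ℕ → ℝ → ℝ}
    (hU : ∀ m ≤ ℓ + 1, ContDiff ℝ 1 (U m)) (hper : ∀ m ≤ ℓ + 1, ∀ x, U m (x + 1) = U m x)
    {Pu : ℕ → Fin N → ℝ[X]}
    (hPu : ∀ m ≤ ℓ + 1, ∀ j, IsGRProj k (ptL pt j) (ptR pt j) (U m) (Pu m j))
    {ρ : ℝ → ℝ} (hρ : Continuous ρ)
    (hrec : ∀ x, U (ℓ+1) x = ∑ m ∈ Finset.range (ℓ+1),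
      (c ℓ m * U m x - τ * d ℓ m * β * deriv (U m) x) + τ * ρ x)
    {uσ : ℕ → Fin N → ℝ[X]} (huσ : ∀ m ≤ ℓ, MemVk k (uσ m)) (j : Fin N) {v : ℝ[X]}
    (hv : v.natDegree ≤ k) :
    cip pt j (rkStage c d τ L uσ ℓ j - Pu (ℓ+1) j) v
      = ∑ m ∈ Finset.range (ℓ+1),
          (c ℓ m * (cip pt j (uσ m j - Pu m j) v
            - ∫ x in (ptL pt j)..(ptR pt j), (U m x - (Pu m j).eval x) * v.eval x)
          + τ * d ℓ m * dgRHS pt β (fun i => uσ m i - Pu m i) j v)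
        - τ * (∫ x in (ptL pt j)..(ptR pt j), ρ x * v.eval x)
        + ∫ x in (ptL pt j)..(ptR pt j), (U (ℓ+1) x - (Pu (ℓ+1) j).eval x) * v.eval x := by
  have hUc : ∀ m ≤ ℓ + 1, Continuous (U m) := fun m hmℓ => (hU m hmℓ).continuous
  have hdc : ∀ m ≤ ℓ + 1, Continuous (deriv (U m)) :=
    fun m hmℓ => (hU m hmℓ).continuous_deriv le_rfl
  have hη : ∀ m ≤ ℓ + 1, ∫ x in (ptL pt j)..(ptR pt j), (U m x - (Pu m j).eval x) * v.eval x
      = (∫ x in (ptL pt j)..(ptR pt j), U m x * v.eval x) - cip pt j (Pu m j) v := by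
    intro m hmℓ
    have := hUc m hmℓ
    unfold cip
    rw [← intervalIntegral.integral_sub]
    · simp only [sub_mul]
    all_goals exact Continuous.intervalIntegrable (by fun_prop) _ _
  have hle : ∀ m ∈ Finset.range (ℓ+1), m ≤ ℓ + 1 := fun m hmr => (Finset.mem_range.mp hmr).le
  have hint : ∫ x in (ptL pt j)..(ptR pt j), U (ℓ+1) x * v.eval x
      = ∑ m ∈ Finset.range (ℓ+1), (c ℓ m * (∫ x in (ptL pt j)..(ptR pt j), U m x * v.eval x)
          - τ * d ℓ m * (β * ∫ x in (ptL pt j)..(ptR pt j), deriv (U m) x * v.eval x))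
        + τ * ∫ x in (ptL pt j)..(ptR pt j), ρ x * v.eval x := by
    have hterm : ∀ m ∈ Finset.range (ℓ+1), Continuous fun x =>
        c ℓ m * (U m x * v.eval x) - τ * d ℓ m * β * (deriv (U m) x * v.eval x) := by
      intro m hmr
      have h1 := hUc m (hle m hmr)
      have h2 := hdc m (hle m hmr)
      fun_prop
    have hpt : ∀ x, U (ℓ+1) x * v.eval x = ∑ m ∈ Finset.range (ℓ+1),
        (c ℓ m * (U m x * v.eval x) - τ * d ℓ m * β * (deriv (U m) x * v.eval x))
          + τ * (ρ x * v.eval x) := by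
      intro x
      rw [hrec x, add_mul, Finset.sum_mul]
      congr 1
      · exact Finset.sum_congr rfl fun m _ => by ring
      · ring
    simp only [hpt]
    rw [intervalIntegral.integral_add
        (Continuous.intervalIntegrable (continuous_finsetSum _ hterm) _ _)
        (Continuous.intervalIntegrable (by fun_prop) _ _),
      intervalIntegral.integral_finsetSum
        (fun m hmr => Continuous.intervalIntegrable (hterm m hmr) _ _),
      intervalIntegral.integral_const_mul]
    congr 1
    refine Finset.sum_congr rfl fun m hmr => ?_
    have h1 := hUc m (hle m hmr)
    have h2 := hdc m (hle m hmr)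
    rw [intervalIntegral.integral_sub (Continuous.intervalIntegrable (by fun_prop) _ _)
        (Continuous.intervalIntegrable (by fun_prop) _ _),
      intervalIntegral.integral_const_mul, intervalIntegral.integral_const_mul, mul_assoc _ β]
  have hsum : ∑ m ∈ Finset.range (ℓ+1),
        (c ℓ m * (cip pt j (uσ m j - Pu m j) v
            - ∫ x in (ptL pt j)..(ptR pt j), (U m x - (Pu m j).eval x) * v.eval x)
          + τ * d ℓ m * dgRHS pt β (fun i => uσ m i - Pu m i) j v)
      = (∑ m ∈ Finset.range (ℓ+1),
          (c ℓ m * cip pt j (uσ m j) v + τ * d ℓ m * cip pt j (L (uσ m) j) v))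
        - ∑ m ∈ Finset.range (ℓ+1), (c ℓ m * (∫ x in (ptL pt j)..(ptR pt j), U m x * v.eval x)
          - τ * d ℓ m * (β * ∫ x in (ptL pt j)..(ptR pt j), deriv (U m) x * v.eval x)) := by
    rw [← Finset.sum_sub_distrib]
    refine Finset.sum_congr rfl fun m hmr => ?_
    rw [hη m (hle m hmr), cip_sub_left, ← hL.cip_add_eq hm (hU m (hle m hmr))
      (hper m (hle m hmr)) (hPu m (hle m hmr))
      (huσ m (Nat.lt_succ_iff.mp (Finset.mem_range.mp hmr))) j hv]
    ring
  have hst : cip pt j (rkStage c d τ L uσ ℓ j) v = ∑ m ∈ Finset.range (ℓ+1),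
      (c ℓ m * cip pt j (uσ m j) v + τ * d ℓ m * cip pt j (L (uσ m) j) v) := by
    unfold rkStage
    rw [cip_sum_left]
    exact Finset.sum_congr rfl fun m _ => by
      rw [cip_add_left, cip_C_mul_left, cip_C_mul_left]
  rw [cip_sub_left, hst, hsum, hη (ℓ+1) le_rfl, hint]
  ring

theorem ip_rkStage_sub_eq [NeZero N] {pt : Fin (N+1) → ℝ} (hm : IsMesh pt) {k ℓ : ℕ}
    {c d : ℕ → ℕ → ℝ} {β τ : ℝ}
    {L : (Fin N → ℝ[X]) → (Fin N → ℝ[X])} (hL : IsDGOp k pt β L) {U : ℕ → ℝ → ℝ}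
    (hU : ∀ m ≤ ℓ + 1, ContDiff ℝ 1 (U m)) (hper : ∀ m ≤ ℓ + 1, ∀ x, U m (x + 1) = U m x)
    {Pu : ℕ → Fin N → ℝ[X]}
    (hPu : ∀ m ≤ ℓ + 1, ∀ j, IsGRProj k (ptL pt j) (ptR pt j) (U m) (Pu m j))
    {ρ : ℝ → ℝ} (hρ : Continuous ρ)
    (hrec : ∀ x, U (ℓ+1) x = ∑ m ∈ Finset.range (ℓ+1),
      (c ℓ m * U m x - τ * d ℓ m * β * deriv (U m) x) + τ * ρ x)
    {uσ : ℕ → Fin N → ℝ[X]} (huσ : ∀ m ≤ ℓ, MemVk k (uσ m)) {v : Fin N → ℝ[X]}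
    (hv : MemVk k v) :
    ip pt (fun j => rkStage c d τ L uσ ℓ j - Pu (ℓ+1) j) v
      = ∑ m ∈ Finset.range (ℓ+1),
          (c ℓ m * (ip pt (fun j => uσ m j - Pu m j) v
            - ipF pt (fun j x => U m x - (Pu m j).eval x) v)
          + τ * d ℓ m * ∑ j, dgRHS pt β (fun i => uσ m i - Pu m i) j (v j))
        - τ * ipF pt (fun _ => ρ) v
        + ipF pt (fun j x => U (ℓ+1) x - (Pu (ℓ+1) j).eval x) v := by
  unfold ip ipF
  simp only [fun j => cip_rkStage_sub_eq hm hL hU hper hPu hρ hrec huσ j (hv j)]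
  rw [Finset.sum_add_distrib, Finset.sum_sub_distrib, ← Finset.mul_sum, Finset.sum_comm]
  simp only [Finset.sum_add_distrib, ← Finset.mul_sum, Finset.sum_sub_distrib]

theorem exists_rkStage_estimate (k ℓ : ℕ) (c d : ℕ → ℕ → ℝ) {β γ CCFL M : ℝ} (hβ : 0 < β)
    (hγ : 1 ≤ γ) (hCCFL : 0 < CCFL) (hM : 0 ≤ M) : ∃ C : ℝ, 0 < C ∧
    ∀ (N : ℕ) [NeZero N] (pt : Fin (N+1) → ℝ), IsMesh pt → QuasiUniform pt γ →
    ∀ τ : ℝ, 0 < τ → τ ≤ 1 → τ ≤ CCFL * meshSize pt →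
    ∀ L : (Fin N → ℝ[X]) → (Fin N → ℝ[X]), IsDGOp k pt β L →
    ∀ U : ℕ → ℝ → ℝ, (∀ m ≤ ℓ + 1, IsRefFun k M (U m)) →
    ∀ Pu : ℕ → Fin N → ℝ[X],
      (∀ m ≤ ℓ + 1, ∀ j, IsGRProj k (ptL pt j) (ptR pt j) (U m) (Pu m j)) →
    ∀ ρ : ℝ → ℝ, Continuous ρ →
      (∀ x, U (ℓ+1) x = ∑ m ∈ Finset.range (ℓ+1),
        (c ℓ m * U m x - τ * d ℓ m * β * deriv (U m) x) + τ * ρ x) →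
    ∀ uσ : ℕ → Fin N → ℝ[X], (∀ m ≤ ℓ, MemVk k (uσ m)) → MemVk k (rkStage c d τ L uσ ℓ) →
      l2 pt (fun j => rkStage c d τ L uσ ℓ j - Pu (ℓ+1) j)
        ≤ C * (∑ m ∈ Finset.range (ℓ+1), l2 pt (fun j => uσ m j - Pu m j)
          + meshSize pt ^ (k+1) + fl2 ρ) := by
  obtain ⟨C₁, hC₁, hdg⟩ := exists_dgRHS_le k hβ hγ
  obtain ⟨C₂, hC₂, hgr⟩ := exists_ipF_gaussRadau_le k hγ hM
  set S := ∑ m ∈ Finset.range (ℓ+1), (|c ℓ m| + |d ℓ m|) with hS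
  have hS0 : 0 ≤ S := Finset.sum_nonneg fun m _ => by positivity
  refine ⟨S * (1 + CCFL * C₁) + (S + 1) * C₂ + 1, by positivity, ?_⟩
  intro N _ pt hm hq τ hτ hτ1 hτh L hL U hU Pu hPu ρ hρ hrec uσ huσ hst
  set h := meshSize pt with hh
  have hpos : 0 < h := hm.meshSize_pos
  set E : ℕ → ℝ := fun m => l2 pt (fun j => uσ m j - Pu m j) with hE
  have hE0 : ∀ m, 0 ≤ E m := fun m => l2_nonneg _ _
  have hρ0 : 0 ≤ fl2 ρ := Real.sqrt_nonneg _
  obtain ⟨T, hT⟩ : ∃ T, T = ∑ m ∈ Finset.range (ℓ+1), E m := ⟨_, rfl⟩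
  have hsE : 0 ≤ T := hT ▸ Finset.sum_nonneg fun m _ => hE0 m
  rw [← hT]
  set v : Fin N → ℝ[X] := fun j => rkStage c d τ L uσ ℓ j - Pu (ℓ+1) j with hv
  have hvk : MemVk k v := fun j =>
    (natDegree_sub_le_of_le (hst j) (hPu (ℓ+1) le_rfl j).1).trans (by simp)
  have hl0 := l2_nonneg pt v
  have hCpos : 0 ≤ S * (1 + CCFL * C₁) + (S + 1) * C₂ + 1 := by positivity
  refine l2_le_of_ip_le hm (mul_nonneg hCpos
    (add_nonneg (add_nonneg hsE (pow_nonneg hpos.le _)) hρ0)) ?_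
  have hid : ip pt v v = ∑ m ∈ Finset.range (ℓ+1),
        (c ℓ m * (ip pt (fun j => uσ m j - Pu m j) v
            - ipF pt (fun j x => U m x - (Pu m j).eval x) v)
          + τ * d ℓ m * ∑ j, dgRHS pt β (fun i => uσ m i - Pu m i) j (v j))
        - τ * ipF pt (fun _ => ρ) v
        + ipF pt (fun j x => U (ℓ+1) x - (Pu (ℓ+1) j).eval x) v := by
    exact ip_rkStage_sub_eq hm hL (fun m hmℓ => (hU m hmℓ).1.of_le (by simp))
      (fun m hmℓ => (hU m hmℓ).2.1) hPu hρ hrec huσ hvk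
  have hterm : ∀ m ∈ Finset.range (ℓ+1),
      |c ℓ m * (ip pt (fun j => uσ m j - Pu m j) v
            - ipF pt (fun j x => U m x - (Pu m j).eval x) v)
          + τ * d ℓ m * ∑ j, dgRHS pt β (fun i => uσ m i - Pu m i) j (v j)|
        ≤ (|c ℓ m| + |d ℓ m|) * (((1 + CCFL * C₁) * T
          + C₂ * h ^ (k+1)) * l2 pt v) := by
    intro m hmr
    have hmℓ : m ≤ ℓ := Nat.lt_succ_iff.mp (Finset.mem_range.mp hmr)
    have hEm : E m ≤ T :=
      hT ▸ Finset.single_le_sum (fun i _ => hE0 i) hmr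
    have e1 := abs_ip_le hm (fun j => uσ m j - Pu m j) v
    have e2 := hgr N pt hm hq (U m) (hU m (by omega)) (Pu m) (hPu m (by omega)) v
    have e3 := hdg N pt hm hq (fun j => uσ m j - Pu m j) v
      (fun j => (natDegree_sub_le_of_le (huσ m hmℓ j) (hPu m (by omega) j).1).trans (by simp)) hvk
    set X := ∑ j, dgRHS pt β (fun i => uσ m i - Pu m i) j (v j)
    have e4 : τ * |X| ≤ CCFL * C₁ * (E m * l2 pt v) := by
      calc τ * |X| ≤ CCFL * h * |X| := by gcongr
        _ = CCFL * (h * |X|) := by ring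
        _ ≤ CCFL * (C₁ * (E m * l2 pt v)) := by gcongr
        _ = _ := by ring
    have hEl : E m * l2 pt v ≤ T * l2 pt v :=
      mul_le_mul_of_nonneg_right hEm hl0
    have hElP : CCFL * C₁ * (E m * l2 pt v)
        ≤ CCFL * C₁ * (T * l2 pt v) :=
      mul_le_mul_of_nonneg_left hEl (by positivity)
    have hEs : 0 ≤ T * l2 pt v := mul_nonneg hsE hl0
    have hEs' : 0 ≤ CCFL * C₁ * (T * l2 pt v) := mul_nonneg (by positivity) hEs
    have hhl : 0 ≤ C₂ * h ^ (k+1) * l2 pt v := by positivity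
    set R := ((1 + CCFL * C₁) * T + C₂ * h ^ (k+1)) * l2 pt v with hR
    have hR' : R = T * l2 pt v
        + CCFL * C₁ * (T * l2 pt v)
        + C₂ * h ^ (k+1) * l2 pt v := by
      rw [hR]
      ring
    calc _ ≤ |c ℓ m| * |ip pt (fun j => uσ m j - Pu m j) v
            - ipF pt (fun j x => U m x - (Pu m j).eval x) v| + |d ℓ m| * (τ * |X|) := by
          refine (abs_add_le _ _).trans_eq ?_
          rw [abs_mul, abs_mul, abs_mul, abs_of_pos hτ]
          ring
      _ ≤ |c ℓ m| * R + |d ℓ m| * R := by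
          apply add_le_add
          · apply mul_le_mul_of_nonneg_left _ (abs_nonneg _)
            refine (abs_sub _ _).trans ?_
            linarith
          · apply mul_le_mul_of_nonneg_left _ (abs_nonneg _)
            linarith
      _ = _ := by ring
  have hρv := abs_ipF_le hm hρ v
  have hηv := hgr N pt hm hq (U (ℓ+1)) (hU _ le_rfl) (Pu (ℓ+1)) (hPu _ le_rfl) v
  have hτρ : |τ * ipF pt (fun _ => ρ) v| ≤ fl2 ρ * l2 pt v := by
    rw [abs_mul, abs_of_pos hτ]
    exact (mul_le_of_le_one_left (abs_nonneg _) hτ1).trans hρv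
  rw [hid]
  calc _ ≤ S * (((1 + CCFL * C₁) * T + C₂ * h ^ (k+1)) * l2 pt v)
        + fl2 ρ * l2 pt v + C₂ * h ^ (k+1) * l2 pt v := by
        refine (abs_add_le _ _).trans (add_le_add ((abs_sub _ _).trans (add_le_add ?_ hτρ)) hηv)
        rw [hS, Finset.sum_mul]
        exact (Finset.abs_sum_le_sum_abs _ _).trans (Finset.sum_le_sum hterm)
    _ = (S * (1 + CCFL * C₁) * T + (S + 1) * C₂ * h ^ (k+1)
          + 1 * fl2 ρ) * l2 pt v := by ring
    _ ≤ _ := by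
        apply mul_le_mul_of_nonneg_right _ hl0
        set P := S * (1 + CCFL * C₁) with hP
        set Q := (S + 1) * C₂ with hQ
        have hP0 : 0 ≤ P := by positivity
        have hQ0 : 0 ≤ Q := by positivity
        have hhk : 0 ≤ h ^ (k+1) := by positivity
        nlinarith [mul_nonneg hP0 hhk, mul_nonneg hP0 hρ0, mul_nonneg hQ0 hsE,
          mul_nonneg hQ0 hρ0]

/-! ### Reference functions -/

/-- `U` is a smooth `1`-periodic function whose `i`-th derivative is bounded by `B i`. -/
def IsSmoothBdd (B : ℕ → ℝ) (U : ℝ → ℝ) : Prop :=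
  ContDiff ℝ (⊤ : ℕ∞) U ∧ (∀ x, U (x + 1) = U x) ∧ ∀ i x, |iteratedDeriv i U x| ≤ B i

theorem IsSmoothBdd.const_mul {B : ℕ → ℝ} {U : ℝ → ℝ} (h : IsSmoothBdd B U) (a : ℝ) :
    IsSmoothBdd (fun i => |a| * B i) (fun x => a * U x) := by
  refine ⟨contDiff_const.mul h.1, fun x => by simp only [h.2.1], fun i x => ?_⟩
  rw [iteratedDeriv_const_mul_field, abs_mul]
  exact mul_le_mul_of_nonneg_left (h.2.2 i x) (abs_nonneg a)

theorem IsSmoothBdd.add {B₁ B₂ : ℕ → ℝ} {U₁ U₂ : ℝ → ℝ} (h₁ : IsSmoothBdd B₁ U₁)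
    (h₂ : IsSmoothBdd B₂ U₂) : IsSmoothBdd (fun i => B₁ i + B₂ i) (fun x => U₁ x + U₂ x) := by
  refine ⟨h₁.1.add h₂.1, fun x => by simp only [h₁.2.1, h₂.2.1], fun i x => ?_⟩
  rw [iteratedDeriv_fun_add (h₁.1.of_le (by exact_mod_cast le_top)).contDiffAt
    (h₂.1.of_le (by exact_mod_cast le_top)).contDiffAt]
  exact (abs_add_le _ _).trans (add_le_add (h₁.2.2 i x) (h₂.2.2 i x))

theorem IsSmoothBdd.deriv {B : ℕ → ℝ} {U : ℝ → ℝ} (h : IsSmoothBdd B U) :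
    IsSmoothBdd (fun i => B (i + 1)) (deriv U) := by
  refine ⟨(contDiff_infty_iff_deriv.mp h.1).2, fun x => ?_, fun i x => ?_⟩
  · simpa only [iteratedDeriv_one] using iteratedDeriv_periodic h.2.1 1 x
  · rw [← iteratedDeriv_succ']
    exact h.2.2 (i + 1) x

theorem IsSmoothBdd.mono {B B' : ℕ → ℝ} {U : ℝ → ℝ} (h : IsSmoothBdd B U)
    (hB : ∀ i, B i ≤ B' i) : IsSmoothBdd B' U :=
  ⟨h.1, h.2.1, fun i x => (h.2.2 i x).trans (hB i)⟩

theorem IsSmoothBdd.nonneg {B : ℕ → ℝ} {U : ℝ → ℝ} (h : IsSmoothBdd B U) (i : ℕ) : 0 ≤ B i :=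
  (abs_nonneg _).trans (h.2.2 i 0)

theorem IsSmoothBdd.sum {ι : Type*} (s : Finset ι) {B : ι → ℕ → ℝ} {U : ι → ℝ → ℝ}
    (h : ∀ m ∈ s, IsSmoothBdd (B m) (U m)) :
    IsSmoothBdd (fun i => ∑ m ∈ s, B m i) (fun x => ∑ m ∈ s, U m x) := by
  classical
  induction s using Finset.induction_on with
  | empty =>
    refine ⟨contDiff_const, fun x => rfl, fun i x => ?_⟩
    simp
  | insert a s ha ih =>
    simp only [Finset.sum_insert ha]
    exact (h a (Finset.mem_insert_self a s)).add
      (ih fun m hms => h m (Finset.mem_insert_of_mem hms))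

theorem IsSmoothSolution.eq_shift {β : ℝ} {u : ℝ → ℝ → ℝ} (hu : IsSmoothSolution β u)
    (x t : ℝ) : u x t = u (x - β * t) 0 := by
  have hF : Differentiable ℝ fun p : ℝ × ℝ => u p.1 p.2 := hu.1.differentiable (by simp)
  have hg : ∀ s, HasDerivAt (fun s => u (x - β * t + β * s) s) 0 s := by
    intro s
    set F' := fderiv ℝ (fun p : ℝ × ℝ => u p.1 p.2) (x - β * t + β * s, s)
    have hF' : HasFDerivAt (fun p : ℝ × ℝ => u p.1 p.2) F' (x - β * t + β * s, s) :=
      (hF _).hasFDerivAt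
    have h1 : HasDerivAt (fun r => u (x - β * t + β * s) r) (F' (0, 1)) s :=
      hF'.comp_hasDerivAt (f := fun r => (x - β * t + β * s, r)) s
        ((hasDerivAt_const s _).prodMk (hasDerivAt_id s))
    have h2 : HasDerivAt (fun y => u y s) (F' (1, 0)) (x - β * t + β * s) :=
      hF'.comp_hasDerivAt (f := fun y => (y, s)) _
        ((hasDerivAt_id _).prodMk (hasDerivAt_const _ s))
    have h3 : HasDerivAt (fun r => u (x - β * t + β * r) r) (F' (β, 1)) s := by
      refine hF'.comp_hasDerivAt (f := fun r => (x - β * t + β * r, r)) s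
        (HasDerivAt.prodMk ?_ (hasDerivAt_id s))
      simpa using ((hasDerivAt_id s).const_mul β).const_add (x - β * t)
    have h4 := hu.2.2 (x - β * t + β * s) s
    rw [h1.deriv, h2.deriv] at h4
    have h5 : F' (β, 1) = 0 := by
      have h6 : ((β, 1) : ℝ × ℝ) = (0, 1) + β • (1, 0) := by ext <;> simp
      rw [h6, map_add, map_smul, smul_eq_mul, h4]
    rwa [h5] at h3
  have h := is_const_of_deriv_eq_zero (fun s => (hg s).differentiableAt)
    (fun s => (hg s).deriv) t 0
  simpa using h

theorem IsSmoothSolution.exists_isSmoothBdd {β : ℝ} {u : ℝ → ℝ → ℝ}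
    (hu : IsSmoothSolution β u) : ∃ B, ∀ t, IsSmoothBdd B (fun x => u x t) := by
  have hφ : ContDiff ℝ (⊤ : ℕ∞) fun x => u x 0 :=
    hu.1.comp (contDiff_id.prodMk contDiff_const)
  have hper : ∀ x, u (x + 1) 0 = u x 0 := fun x => hu.2.1 x 0
  have hbd : ∀ i, ∃ B, ∀ x, |iteratedDeriv i (fun x => u x 0) x| ≤ B := by
    intro i
    have hc : Continuous (iteratedDeriv i fun x => u x 0) :=
      hφ.continuous_iteratedDeriv i (by exact_mod_cast le_top)
    obtain ⟨B, hB⟩ := (isCompact_Icc (a := (0:ℝ)) (b := 1)).exists_bound_of_continuousOn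
      hc.continuousOn
    refine ⟨B, fun x => ?_⟩
    have hp : Function.Periodic (iteratedDeriv i fun x => u x 0) 1 :=
      iteratedDeriv_periodic hper i
    obtain ⟨y, hy, hxy⟩ := hp.exists_mem_Ico₀ one_pos x
    rw [hxy]
    exact hB y ⟨hy.1, hy.2.le⟩
  choose B hB using hbd
  refine ⟨B, fun t => ⟨hu.1.comp (contDiff_id.prodMk contDiff_const), fun x => hu.2.1 x t,
    fun i x => ?_⟩⟩
  have h1 : (fun x => u x t) = fun x => u (x - β * t) 0 := funext fun x => hu.eq_shift x t
  rw [h1, iteratedDeriv_comp_sub_const i (fun x => u x 0) (β * t)]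
  exact hB i _

theorem UrefUpTo_eq_Uref (u : ℝ → ℝ → ℝ) (c d : ℕ → ℕ → ℝ) (β τ : ℝ) (n : ℕ) {i ℓ : ℕ}
    (h : i ≤ ℓ) : UrefUpTo u c d β τ n ℓ i = Uref u c d β τ n i := by
  induction ℓ with
  | zero =>
    obtain rfl : i = 0 := by omega
    rfl
  | succ ℓ ih =>
    rcases Nat.lt_or_ge ℓ i with hi | hi
    · obtain rfl : i = ℓ + 1 := by omega
      rfl
    · exact (if_pos hi).trans (ih hi)

theorem Uref_succ (u : ℝ → ℝ → ℝ) (c d : ℕ → ℕ → ℝ) (β τ : ℝ) (n ℓ : ℕ) :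
    Uref u c d β τ n (ℓ+1) = fun x => ∑ m ∈ Finset.range (ℓ+1),
      (c ℓ m * Uref u c d β τ n m x - τ * d ℓ m * β * deriv (Uref u c d β τ n m) x) := by
  refine (if_neg (Nat.not_succ_le_self ℓ)).trans ?_
  funext x
  refine Finset.sum_congr rfl fun m hmr => ?_
  rw [UrefUpTo_eq_Uref u c d β τ n (Nat.lt_succ_iff.mp (Finset.mem_range.mp hmr))]

theorem isSmoothBdd_stage {B : ℕ → ℕ → ℝ} {U : ℕ → ℝ → ℝ} {c d : ℕ → ℕ → ℝ} {β τ : ℝ}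
    (hτ : 0 < τ) (hτ1 : τ ≤ 1) {ℓ p : ℕ} (hU : ∀ m < p, IsSmoothBdd (B m) (U m)) :
    IsSmoothBdd
      (fun i => ∑ m ∈ Finset.range p, (|c ℓ m| * B m i + |d ℓ m * β| * B m (i + 1)))
      (fun x => ∑ m ∈ Finset.range p, (c ℓ m * U m x - τ * d ℓ m * β * deriv (U m) x)) := by
  refine IsSmoothBdd.sum _ fun m hmr => ?_
  have h := hU m (Finset.mem_range.mp hmr)
  have h1 := (h.const_mul (c ℓ m)).add (h.deriv.const_mul (-(τ * d ℓ m * β)))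
  have h2 : (fun x => c ℓ m * U m x - τ * d ℓ m * β * deriv (U m) x)
      = fun x => c ℓ m * U m x + -(τ * d ℓ m * β) * deriv (U m) x := by
    funext x
    ring
  rw [h2]
  refine h1.mono fun i => ?_
  have h3 := h.nonneg (i + 1)
  apply add_le_add_right
  apply mul_le_mul_of_nonneg_right _ h3
  rw [abs_neg, mul_assoc, abs_mul, abs_of_pos hτ]
  exact mul_le_of_le_one_left (abs_nonneg _) hτ1

theorem exists_isSmoothBdd_Uref {β : ℝ} {u : ℝ → ℝ → ℝ} (hu : IsSmoothSolution β u)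
    (c d : ℕ → ℕ → ℝ) (ℓ : ℕ) : ∃ B : ℕ → ℕ → ℝ, ∀ m ≤ ℓ, ∀ τ : ℝ, 0 < τ → τ ≤ 1 → ∀ n : ℕ,
      IsSmoothBdd (B m) (Uref u c d β τ n m) := by
  induction ℓ with
  | zero =>
    obtain ⟨B, hB⟩ := hu.exists_isSmoothBdd
    refine ⟨fun _ => B, fun m hmℓ τ _ _ n => ?_⟩
    obtain rfl : m = 0 := by omega
    exact hB _
  | succ ℓ ih =>
    obtain ⟨B, hB⟩ := ih
    refine ⟨Function.update B (ℓ+1) fun i => ∑ m ∈ Finset.range (ℓ+1),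
      (|c ℓ m| * B m i + |d ℓ m * β| * B m (i + 1)), fun m hmℓ τ hτ hτ1 n => ?_⟩
    rcases Nat.lt_or_ge ℓ m with hi | hi
    · obtain rfl : m = ℓ + 1 := by omega
      rw [Function.update_self, Uref_succ]
      exact isSmoothBdd_stage hτ hτ1 fun m hm => hB m (by omega) τ hτ hτ1 n
    · rw [Function.update_of_ne (by omega)]
      exact hB m hi τ hτ hτ1 n

theorem exists_isRefFun_UrefS {β : ℝ} {u : ℝ → ℝ → ℝ} (hu : IsSmoothSolution β u)
    (c d : ℕ → ℕ → ℝ) (k s : ℕ) : ∃ M : ℝ, 0 ≤ M ∧ ∀ m ≤ s, ∀ τ : ℝ, 0 < τ → τ ≤ 1 → ∀ n : ℕ,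
      IsRefFun k M (UrefS u c d β τ s n m) := by
  obtain ⟨B₀, hB₀⟩ := hu.exists_isSmoothBdd
  obtain ⟨B, hB⟩ := exists_isSmoothBdd_Uref hu c d s
  have hpos : ∀ m ≤ s, ∀ i, 0 ≤ B m i := fun m hms i => (hB m hms 1 one_pos le_rfl 0).nonneg i
  have hpos₀ : ∀ i, 0 ≤ B₀ i := (hB₀ 0).nonneg
  have hsum : ∀ m ∈ Finset.range (s+1), 0 ≤ ∑ i ∈ Finset.range (k+2), B m i := fun m hmr =>
    Finset.sum_nonneg fun i _ => hpos m (Nat.lt_succ_iff.mp (Finset.mem_range.mp hmr)) i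
  have hsum₀ : 0 ≤ ∑ i ∈ Finset.range (k+2), B₀ i := Finset.sum_nonneg fun i _ => hpos₀ i
  refine ⟨∑ i ∈ Finset.range (k+2), B₀ i
    + ∑ m ∈ Finset.range (s+1), ∑ i ∈ Finset.range (k+2), B m i,
    add_nonneg hsum₀ (Finset.sum_nonneg hsum), fun m hms τ hτ hτ1 n => ?_⟩
  unfold UrefS
  split_ifs with h
  · have h1 := hB₀ (((n:ℝ)+1) * τ)
    refine ⟨h1.1, h1.2.1, fun i hi x => (h1.2.2 i x).trans ?_⟩
    have h2 := Finset.single_le_sum (f := B₀) (fun i _ => hpos₀ i)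
      (Finset.mem_range.mpr (show i < k + 2 by omega))
    have h3 := Finset.sum_nonneg hsum
    linarith
  · have h1 := hB m hms τ hτ hτ1 n
    refine ⟨h1.1, h1.2.1, fun i hi x => (h1.2.2 i x).trans ?_⟩
    have h2 := Finset.single_le_sum (f := B m) (fun i _ => hpos m hms i)
      (Finset.mem_range.mpr (show i < k + 2 by omega))
    have h3 := Finset.single_le_sum hsum (Finset.mem_range.mpr (show m < s + 1 by omega))
    linarith

theorem continuous_rkRes {β : ℝ} {u : ℝ → ℝ → ℝ} (hu : IsSmoothSolution β u)
    (c d : ℕ → ℕ → ℝ) (s n : ℕ) {τ : ℝ} (hτ : 0 < τ) (hτ1 : τ ≤ 1) :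
    Continuous (rkRes u c d β τ s n) := by
  obtain ⟨B₀, hB₀⟩ := hu.exists_isSmoothBdd
  obtain ⟨B, hB⟩ := exists_isSmoothBdd_Uref hu c d s
  have h1 := (hB₀ (((n:ℝ)+1) * τ)).1.continuous
  have h2 := (isSmoothBdd_stage (c := c) (d := d) (β := β) (ℓ := s - 1) hτ hτ1
    (fun m (hm : m < s) => hB m hm.le τ hτ hτ1 n)).1.continuous
  exact (h1.sub h2).div_const τ

/-! ### Combination over the stages -/

theorem UrefS_succ {u : ℝ → ℝ → ℝ} {c d : ℕ → ℕ → ℝ} {β τ : ℝ} (hτ : 0 < τ) {s ℓ : ℕ} (n : ℕ)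
    (hℓ : ℓ < s) (x : ℝ) :
    UrefS u c d β τ s n (ℓ+1) x = ∑ m ∈ Finset.range (ℓ+1), (c ℓ m * UrefS u c d β τ s n m x
        - τ * d ℓ m * β * deriv (UrefS u c d β τ s n m) x)
      + τ * (if ℓ + 1 = s then rkRes u c d β τ s n else fun _ => 0) x := by
  have h1 : ∀ m ∈ Finset.range (ℓ+1), UrefS u c d β τ s n m = Uref u c d β τ n m :=
    fun m hmr => if_neg (by have := Finset.mem_range.mp hmr; omega)
  rw [Finset.sum_congr rfl fun m hmr => by rw [h1 m hmr]]
  unfold UrefS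
  split_ifs with h
  · subst h
    simp only [rkRes, Nat.add_sub_cancel]
    rw [mul_div_cancel₀ _ hτ.ne']
    ring
  · rw [Uref_succ, mul_zero, add_zero]

theorem IsOEDGStep.memVk [NeZero N] {k s : ℕ} {c d : ℕ → ℕ → ℝ} {β τ : ℝ}
    {pt : Fin (N+1) → ℝ} {Pc : Fin N → ℕ → ℝ[X] → ℝ[X]}
    {L Fτ : (Fin N → ℝ[X]) → (Fin N → ℝ[X])} (hL : IsDGOp k pt β L)
    (hF : IsOEOp k pt (fun _ => β) Pc τ Fτ) {un : Fin N → ℝ[X]} {uh uσ : ℕ → Fin N → ℝ[X]}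
    (hun : MemVk k un) (hstep : IsOEDGStep s c d τ L Fτ un uh uσ) {ℓ : ℕ} (hℓ : ℓ ≤ s) :
    (∀ m ≤ ℓ, MemVk k (uσ m)) ∧ ∀ m < ℓ, MemVk k (uh (m+1)) := by
  induction ℓ with
  | zero =>
    refine ⟨fun m hm => ?_, fun m hm => by omega⟩
    obtain rfl : m = 0 := by omega
    rwa [hstep.1]
  | succ ℓ ih =>
    obtain ⟨ih₁, ih₂⟩ := ih (by omega)
    have hu : MemVk k (uh (ℓ+1)) := by
      rw [(hstep.2 ℓ hℓ).1]
      intro j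
      refine natDegree_sum_le_of_forall_le _ _ fun m hmr => ?_
      have hm := ih₁ m (Nat.lt_succ_iff.mp (Finset.mem_range.mp hmr))
      exact natDegree_add_le_of_degree_le ((natDegree_C_mul_le _ _).trans (hm j))
        ((natDegree_C_mul_le _ _).trans ((hL _ hm).1 j))
    have huσ : MemVk k (uσ (ℓ+1)) := by
      obtain ⟨W, hW, hFW⟩ := hF _ hu
      rw [(hstep.2 ℓ hℓ).2, hFW]
      exact hW.2.1 τ
    constructor
    · intro m hm
      rcases Nat.lt_or_ge ℓ m with hi | hi
      · obtain rfl : m = ℓ + 1 := by omega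
        exact huσ
      · exact ih₁ m hi
    · intro m hm
      rcases Nat.lt_or_ge m ℓ with hi | hi
      · exact ih₂ m hi
      · obtain rfl : m = ℓ := by omega
        exact hu

theorem exists_bound_of_recurrence {C₁ C₂ : ℝ} (hC₁ : 0 ≤ C₁) (hC₂ : 0 ≤ C₂) (s : ℕ) :
    ∃ C : ℝ, 0 ≤ C ∧ ∀ (a b : ℕ → ℝ) (E : ℝ), 0 ≤ E → a 0 ≤ E → ∀ p ≤ s,
      (∀ m < p, b (m+1) ≤ C₁ * (∑ i ∈ Finset.range (m+1), a i + E)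
        ∧ a (m+1) ≤ C₂ * (b (m+1) + E)) → ∀ m ≤ p, a m ≤ C * E := by
  induction s with
  | zero =>
    refine ⟨1, zero_le_one, fun a b E _ h0 p hp _ m hm => ?_⟩
    obtain rfl : m = 0 := by omega
    rwa [one_mul]
  | succ s ih =>
    obtain ⟨C, hC, h⟩ := ih
    refine ⟨C + C₂ * (C₁ * ((s + 1) * C + 1) + 1), by positivity, ?_⟩
    intro a b E hE h0 p hp hrec m hm
    rcases Nat.lt_or_ge s m with hi | hi
    · obtain rfl : m = s + 1 := by omega
      have ha : ∀ i ∈ Finset.range (s+1), a i ≤ C * E := fun i hir =>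
        h a b E hE h0 s le_rfl (fun q hq => hrec q (by omega)) i
          (Nat.lt_succ_iff.mp (Finset.mem_range.mp hir))
      have hsum : ∑ i ∈ Finset.range (s+1), a i ≤ (s + 1) * (C * E) := by
        refine (Finset.sum_le_sum ha).trans_eq ?_
        simp
      obtain ⟨hb, ha'⟩ := hrec s (by omega)
      calc a (s+1) ≤ C₂ * (b (s+1) + E) := ha'
        _ ≤ C₂ * (C₁ * ((s + 1) * (C * E) + E) + E) := by
            apply mul_le_mul_of_nonneg_left _ hC₂
            apply add_le_add_left
            refine hb.trans (mul_le_mul_of_nonneg_left ?_ hC₁)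
            exact add_le_add_left hsum E
        _ = C₂ * (C₁ * ((s + 1) * C + 1) + 1) * E := by ring
        _ ≤ _ := by
            apply mul_le_mul_of_nonneg_right _ hE
            linarith
    · refine (h a b E hE h0 m hi (fun q hq => hrec q (by omega)) m le_rfl).trans ?_
      apply mul_le_mul_of_nonneg_right _ hE
      have : 0 ≤ C₂ * (C₁ * ((s + 1) * C + 1) + 1) := by positivity
      linarith

/-- Lemma 4.4, 1D case.  With
`Y^{n,ℓ}(v) = τ⁻¹ ∫_Ω (u_σ^{n,ℓ+1} - u_h^{n,ℓ+1}) v dx`,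
`ξ^{n,m} = u_h^{n,m} - P* U^{n,m}` and `ξ_σ^n = u_σ^{n,0} - P* U^{n,0}`,
if `‖ξ^{n,m}‖_{L∞(Ω)} ≤ h` for all `1 ≤ m ≤ ℓ+1`, then
`‖Y^{n,ℓ}‖ ≤ C (‖ξ_σ^n‖_{L²(Ω)} + h^{k+1} + τ^r)` with `C` independent of `h, τ, n`. -/
theorem Y_estimate
    (k s r : ℕ) (hs : 1 ≤ s)
    (c d : ℕ → ℕ → ℝ) (hc : ∀ ℓ < s, ∑ m ∈ Finset.range (ℓ+1), c ℓ m = 1)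
    (β γ CCFL κ Cr c0 : ℝ)
    (hβ : 0 < β) (hγ : 1 ≤ γ) (hCCFL : 0 < CCFL) (hκ : 1 ≤ κ) (hCr : 0 ≤ Cr)
    (hc0 : 0 < c0)
    (u : ℝ → ℝ → ℝ) (hu : IsSmoothSolution β u) :
    ∃ C : ℝ, 0 < C ∧
      ∀ (N : ℕ) [NeZero N] (pt : Fin (N+1) → ℝ),
        IsMesh pt → QuasiUniform pt γ → meshSize pt ≤ 1 →
      ∀ τ : ℝ, 0 < τ → τ ≤ 1 → τ ≤ CCFL * meshSize pt ^ κ →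
      ∀ n : ℕ, fl2 (rkRes u c d β τ s n) ≤ Cr * τ ^ r →
      ∀ Pstar : (ℝ → ℝ) → Fin N → Polynomial ℝ,
        (∀ W : ℝ → ℝ, Continuous W → ∀ j,
          IsGRProj k (ptL pt j) (ptR pt j) W (Pstar W j)) →
      ∀ Pc : Fin N → ℕ → Polynomial ℝ → Polynomial ℝ, IsCellProj pt Pc →
      ∀ L Fτ : (Fin N → Polynomial ℝ) → (Fin N → Polynomial ℝ),
        IsDGOp k pt β L → IsOEOp k pt (fun _ => β) Pc τ Fτ →
      ∀ (un : Fin N → Polynomial ℝ) (uh uσ : ℕ → Fin N → Polynomial ℝ),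
        MemVk k un → IsOEDGStep s c d τ L Fτ un uh uσ →
        (∀ m, 1 ≤ m → m ≤ s → c0 ≤ linfSub pt (uh m) (avg pt (uh m))) →
      ∀ ℓ < s,
        (∀ m, 1 ≤ m → m ≤ ℓ+1 →
          linfSub pt (fun j => uh m j - Pstar (UrefS u c d β τ s n m) j) 0
            ≤ meshSize pt) →
      ∀ v : Fin N → Polynomial ℝ, MemVk k v →
        |τ⁻¹ * ip pt (fun j => uσ (ℓ+1) j - uh (ℓ+1) j) v|
          ≤ C * (l2 pt (fun j => uσ 0 j - Pstar (UrefS u c d β τ s n 0) j)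
              + meshSize pt ^ (k+1) + τ ^ r) * l2 pt v := by
  obtain ⟨M, hM, hU⟩ := exists_isRefFun_UrefS hu c d k s
  obtain ⟨CD, hCD, hdamp⟩ := exists_damping_estimate k hβ hγ hc0 hM
  choose CR hCR hrk using fun ℓ => exists_rkStage_estimate k ℓ c d hβ hγ hCCFL hM
  set C₁ := (∑ i ∈ Finset.range s, CR i) * (1 + Cr) with hC₁
  have hCRle : ∀ ℓ < s, CR ℓ ≤ ∑ i ∈ Finset.range s, CR i := fun ℓ hℓ =>
    Finset.single_le_sum (fun i _ => (hCR i).le) (Finset.mem_range.mpr hℓ)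
  have hCRs : 0 ≤ ∑ i ∈ Finset.range s, CR i := Finset.sum_nonneg fun i _ => (hCR i).le
  have hC₁0 : 0 ≤ C₁ := mul_nonneg hCRs (by linarith)
  obtain ⟨C₀, hC₀, hbd⟩ := exists_bound_of_recurrence hC₁0
    (by linarith : 0 ≤ 1 + CD) s
  refine ⟨CD * (C₁ * (s * C₀ + 1) + 1), by positivity, ?_⟩
  intro N _ pt hm hq hh1 τ hτ hτ1 hτh n hρ Pstar hPs Pc hPc L Fτ hL hF un uh uσ hun hstep hlow
    ℓ hℓ hξ v hv
  have hpos : 0 < meshSize pt := hm.meshSize_pos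
  have hτh' : τ ≤ CCFL * meshSize pt := by
    refine hτh.trans (mul_le_mul_of_nonneg_left ?_ hCCFL.le)
    simpa using Real.rpow_le_rpow_of_exponent_ge hpos hh1 hκ
  set U : ℕ → ℝ → ℝ := fun m => UrefS u c d β τ s n m with hUdef
  have hUr : ∀ m ≤ s, IsRefFun k M (U m) := fun m hms => hU m hms τ hτ hτ1 n
  have hPu : ∀ m ≤ s, ∀ j, IsGRProj k (ptL pt j) (ptR pt j) (U m) (Pstar (U m) j) :=
    fun m hms j => hPs (U m) (hUr m hms).1.continuous j
  obtain ⟨hmemσ, hmemh⟩ := hstep.memVk hL hF hun le_rfl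
  obtain ⟨a, ha⟩ : ∃ a : ℕ → ℝ, a = fun m => l2 pt (fun j => uσ m j - Pstar (U m) j) := ⟨_, rfl⟩
  obtain ⟨b, hb⟩ : ∃ b : ℕ → ℝ, b = fun m => l2 pt (fun j => uh m j - Pstar (U m) j) := ⟨_, rfl⟩
  have ha0 : ∀ m, 0 ≤ a m := fun m => ha ▸ l2_nonneg _ _
  have hb0 : ∀ m, 0 ≤ b m := fun m => hb ▸ l2_nonneg _ _
  have hH : 0 < meshSize pt ^ (k+1) := pow_pos hpos _
  have hτr : 0 < τ ^ r := pow_pos hτ r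
  set E := a 0 + meshSize pt ^ (k+1) + τ ^ r with hE
  have hE0 : 0 ≤ E := by
    have := ha0 0
    positivity
  have hHE : meshSize pt ^ (k+1) ≤ E := by linarith [ha0 0]
  have hrkb : ∀ m < s, b (m+1) ≤ C₁ * (∑ i ∈ Finset.range (m+1), a i + E) := by
    intro m hms
    set ρ : ℝ → ℝ := if m + 1 = s then rkRes u c d β τ s n else fun _ => 0 with hρdef
    have hρc : Continuous ρ := by
      rw [hρdef]
      split_ifs
      · exact continuous_rkRes hu c d s n hτ hτ1
      · exact continuous_const
    have hρb : fl2 ρ ≤ Cr * τ ^ r := by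
      rw [hρdef]
      split_ifs
      · exact hρ
      · simpa [fl2] using mul_nonneg hCr hτr.le
    have hst := (hstep.2 m hms).1
    have h1 := hrk m N pt hm hq τ hτ hτ1 hτh' L hL U (fun i hi => hUr i (by omega))
      (fun i => Pstar (U i)) (fun i hi => hPu i (by omega)) ρ hρc (UrefS_succ hτ n hms) uσ
      (fun i hi => hmemσ i (by omega)) (hst ▸ hmemh m hms)
    rw [← hst] at h1
    have hsa : 0 ≤ ∑ i ∈ Finset.range (m+1), a i := Finset.sum_nonneg fun i _ => ha0 i
    calc b (m+1) ≤ CR m * (∑ i ∈ Finset.range (m+1), a i + meshSize pt ^ (k+1) + fl2 ρ) := by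
          rw [ha, hb]
          exact h1
      _ ≤ CR m * ((1 + Cr) * (∑ i ∈ Finset.range (m+1), a i + E)) := by
          apply mul_le_mul_of_nonneg_left _ (hCR m).le
          have := mul_nonneg hCr (add_nonneg (add_nonneg hsa (ha0 0)) hH.le)
          rw [hE]
          nlinarith [ha0 0]
      _ ≤ (∑ i ∈ Finset.range s, CR i)
            * ((1 + Cr) * (∑ i ∈ Finset.range (m+1), a i + E)) :=
          mul_le_mul_of_nonneg_right (hCRle m hms)
            (mul_nonneg (by linarith) (add_nonneg hsa hE0))
      _ = _ := by
          rw [hC₁]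
          ring
  have hdampv : ∀ m ≤ ℓ, ∀ v : Fin N → ℝ[X], MemVk k v →
      |ip pt (fun j => uσ (m+1) j - uh (m+1) j) v|
        ≤ τ * (CD * (b (m+1) + meshSize pt ^ (k+1))) * l2 pt v := by
    intro m hmℓ v hv
    obtain ⟨W, hW, hFW⟩ := hF _ (hmemh m (by omega))
    have h1 := hdamp N pt hm hq hh1 τ hτ (U (m+1)) (hUr (m+1) (by omega)) (Pstar (U (m+1)))
      (hPu (m+1) (by omega)) Pc hPc (uh (m+1)) (hmemh m (by omega))
      (hlow (m+1) (by omega) (by omega)) (hξ (m+1) (by omega) (by omega)) W hW v hv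
    rw [(hstep.2 m (by omega)).2, hFW, hb]
    exact h1
  have hdampa : ∀ m < ℓ, a (m+1) ≤ (1 + CD) * (b (m+1) + E) := by
    intro m hmℓ
    set w : Fin N → ℝ[X] := fun j => uσ (m+1) j - Pstar (U (m+1)) j with hw
    have hwk : MemVk k w := fun j =>
      (natDegree_sub_le_of_le (hmemσ (m+1) (by omega) j) (hPu (m+1) (by omega) j).1).trans
        (by simp)
    have h1 := hdampv m hmℓ.le w hwk
    have h2 := abs_ip_le hm (fun j => uh (m+1) j - Pstar (U (m+1)) j) w
    have h3 : ip pt w w = ip pt (fun j => uh (m+1) j - Pstar (U (m+1)) j) w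
        + ip pt (fun j => uσ (m+1) j - uh (m+1) j) w := by
      unfold ip
      rw [← Finset.sum_add_distrib]
      refine Finset.sum_congr rfl fun j _ => ?_
      rw [← cip_add_left]
      congr 1
      simp only [hw]
      ring
    have hl0 := l2_nonneg pt w
    have hb1 := hb0 (m+1)
    have hbm : l2 pt (fun j => uh (m+1) j - Pstar (U (m+1)) j) = b (m+1) := by rw [hb]
    rw [hbm] at h2
    have h4 : τ * (CD * (b (m+1) + meshSize pt ^ (k+1))) ≤ CD * (b (m+1) + E) := by
      calc _ ≤ CD * (b (m+1) + meshSize pt ^ (k+1)) :=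
            mul_le_of_le_one_left (by positivity) hτ1
        _ ≤ _ := mul_le_mul_of_nonneg_left (by linarith) hCD.le
    have h5 : a (m+1) = l2 pt w := by rw [ha]
    rw [h5]
    refine l2_le_of_ip_le hm (by positivity) ?_
    rw [h3]
    calc _ ≤ b (m+1) * l2 pt w + CD * (b (m+1) + E) * l2 pt w :=
          (abs_add_le _ _).trans
            (add_le_add h2 (h1.trans (mul_le_mul_of_nonneg_right h4 hl0)))
      _ ≤ (b (m+1) + E) * l2 pt w + CD * (b (m+1) + E) * l2 pt w := by
          gcongr
          linarith
      _ = _ := by ring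
  have hall := hbd a b E hE0 (by linarith) ℓ hℓ.le
    fun m hmℓ => ⟨hrkb m (by omega), hdampa m hmℓ⟩
  have hsum : ∑ i ∈ Finset.range (ℓ+1), a i ≤ s * (C₀ * E) := by
    calc _ ≤ ∑ i ∈ Finset.range (ℓ+1), C₀ * E := Finset.sum_le_sum fun i hi =>
          hall i (Nat.lt_succ_iff.mp (Finset.mem_range.mp hi))
      _ = ((ℓ + 1 : ℕ) : ℝ) * (C₀ * E) := by simp
      _ ≤ _ := by
          apply mul_le_mul_of_nonneg_right _ (by positivity)
          exact_mod_cast hℓ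
  have hbℓ : b (ℓ+1) + meshSize pt ^ (k+1) ≤ (C₁ * (s * C₀ + 1) + 1) * E := by
    calc _ ≤ C₁ * (s * (C₀ * E) + E) + E :=
          add_le_add ((hrkb ℓ hℓ).trans (mul_le_mul_of_nonneg_left (by linarith) hC₁0)) hHE
      _ = _ := by ring
  have hl0 := l2_nonneg pt v
  have hfin := hdampv ℓ le_rfl v hv
  rw [abs_mul, abs_of_pos (inv_pos.mpr hτ)]
  have hEeq : l2 pt (fun j => uσ 0 j - Pstar (U 0) j) + meshSize pt ^ (k+1) + τ ^ r = E := by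
    rw [hE, ha]
  calc _ ≤ τ⁻¹ * (τ * (CD * (b (ℓ+1) + meshSize pt ^ (k+1))) * l2 pt v) :=
        mul_le_mul_of_nonneg_left hfin (inv_pos.mpr hτ).le
    _ = CD * (b (ℓ+1) + meshSize pt ^ (k+1)) * l2 pt v := by field_simp
    _ ≤ CD * ((C₁ * (s * C₀ + 1) + 1) * E) * l2 pt v := by gcongr
    _ = CD * (C₁ * (s * C₀ + 1) + 1) * E * l2 pt v := by ring
    _ = _ := by rw [← hEeq]

end OEDG
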